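/- arXiv:2601.13726 — 9 statements merged into one kernel-verified Lean document; each statement's English description precedes it below -/
import Mathlib

section
/- For every c ∈ (0,1), the double series Σ_{p,q∈ℕ} Vol(p^{-1}·Δ_∞ ∩ q^{-1}·Δ_c) converges to a finite value, and its sum is strictly positive. -/
open MeasureTheory
open scoped ENNReal Pointwise

noncomputable section

/-- `Δ_∞ = {0 < |x₁x₂|·y ≤ 1}`. -/
def DeltaInf : Set (ℝ × ℝ × ℝ) :=
  {v | 0 < |v.1 * v.2.1| * v.2.2 ∧ |v.1 * v.2.1| * v.2.2 ≤ 1}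

/-- `Δ_c = {0 < |x₁x₂|·y ≤ 1, e⁻¹c < |x₁|,|x₂| ≤ c}`. -/
def DeltaC (c : ℝ) : Set (ℝ × ℝ × ℝ) :=
  {v | 0 < |v.1 * v.2.1| * v.2.2 ∧ |v.1 * v.2.1| * v.2.2 ≤ 1 ∧
    (Real.exp 1)⁻¹ * c < |v.1| ∧ |v.1| ≤ c ∧
    (Real.exp 1)⁻¹ * c < |v.2.1| ∧ |v.2.1| ≤ c}

theorem mem_natCast_inv_smul_iff (n : ℕ+) (S : Set (ℝ × ℝ × ℝ)) (v : ℝ × ℝ × ℝ) :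
    v ∈ ((n : ℕ) : ℝ)⁻¹ • S ↔ ((n : ℕ) : ℝ) • v ∈ S := by
  have hn : ((n : ℕ) : ℝ) ≠ 0 := by exact_mod_cast n.ne_zero
  rw [Set.mem_smul_set_iff_inv_smul_mem₀ (inv_ne_zero hn), inv_inv]

/-- The intersection of the two dilated sets lies in a box of volume `O((pq)^(-3/2))`. -/
theorem inv_smul_DeltaInf_inter_inv_smul_DeltaC_subset {c : ℝ} (hc : 0 < c) (p q : ℕ+) :
    (((p : ℕ) : ℝ)⁻¹ • DeltaInf) ∩ (((q : ℕ) : ℝ)⁻¹ • DeltaC c) ⊆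
      Set.Icc (-(c / (q : ℕ))) (c / (q : ℕ)) ×ˢ Set.Icc (-(c / (q : ℕ))) (c / (q : ℕ)) ×ˢ
        Set.Icc 0 ((Real.exp 1) ^ 2 * ((q : ℕ) : ℝ) ^ 2 / c ^ 2 *
          (((p : ℕ) : ℝ) ^ (-(3 / 2) : ℝ) * ((q : ℕ) : ℝ) ^ (-(3 / 2) : ℝ))) := by
  rintro ⟨x, z, y⟩ ⟨hp, hq⟩
  rw [mem_natCast_inv_smul_iff] at hp hq
  have hp0 : (0 : ℝ) < (p : ℕ) := by exact_mod_cast p.pos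
  have hq0 : (0 : ℝ) < (q : ℕ) := by exact_mod_cast q.pos
  generalize ((p : ℕ) : ℝ) = P at *
  generalize ((q : ℕ) : ℝ) = Q at *
  simp only [DeltaInf, DeltaC, Set.mem_ofPred_eq, Prod.smul_mk, smul_eq_mul, abs_mul,
    abs_of_pos hp0, abs_of_pos hq0] at hp hq
  obtain ⟨-, hp1⟩ := hp
  obtain ⟨hq2, hq1, hx1, hx2, hz1, hz2⟩ := hq
  have hxc : |x| ≤ c / Q := by rw [le_div_iff₀ hq0]; linarith
  have hzc : |z| ≤ c / Q := by rw [le_div_iff₀ hq0]; linarith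
  have hec : 0 < (Real.exp 1)⁻¹ * c := by positivity
  have hx0 : 0 < Q * |x| := hec.trans hx1
  have hz0 : 0 < Q * |z| := hec.trans hz1
  have hy : 0 < y := pos_of_mul_pos_right (by linarith : 0 < Q * |x| * (Q * |z|) * Q * y)
    (by positivity)
  refine ⟨abs_le.mp hxc, abs_le.mp hzc, hy.le, ?_⟩
  dsimp only
  set a := |x| * |z| * y with ha
  have ha0 : 0 ≤ a := by positivity
  have hpa : P ^ 3 * a ≤ 1 := by rw [ha]; linarith
  have hqa : Q ^ 3 * a ≤ 1 := by rw [ha]; linarith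
  have haPQ : a ≤ P ^ (-(3 / 2) : ℝ) * Q ^ (-(3 / 2) : ℝ) := by
    have hP : (P ^ (-(3 / 2) : ℝ)) ^ 2 = (P ^ 3)⁻¹ := by
      rw [← Real.rpow_natCast, ← Real.rpow_mul hp0.le, ← Real.rpow_natCast P 3,
        ← Real.rpow_neg hp0.le]
      norm_num
    have hQ : (Q ^ (-(3 / 2) : ℝ)) ^ 2 = (Q ^ 3)⁻¹ := by
      rw [← Real.rpow_natCast, ← Real.rpow_mul hq0.le, ← Real.rpow_natCast Q 3,
        ← Real.rpow_neg hq0.le]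
      norm_num
    refine (sq_le_sq₀ ha0 (by positivity)).mp ?_
    rw [mul_pow (P ^ (-(3 / 2) : ℝ)), hP, hQ, sq]
    have h1 : a ≤ (P ^ 3)⁻¹ := by
      rwa [← one_div, le_div_iff₀' (by positivity)]
    have h2 : a ≤ (Q ^ 3)⁻¹ := by
      rwa [← one_div, le_div_iff₀' (by positivity)]
    gcongr
  have hxz : ((Real.exp 1)⁻¹ * c) * ((Real.exp 1)⁻¹ * c) ≤ (Q * |x|) * (Q * |z|) := by gcongr
  calc y = (Real.exp 1) ^ 2 / c ^ 2 * (((Real.exp 1)⁻¹ * c) * ((Real.exp 1)⁻¹ * c) * y) := by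
        field_simp
    _ ≤ (Real.exp 1) ^ 2 / c ^ 2 * ((Q * |x|) * (Q * |z|) * y) := by gcongr
    _ = (Real.exp 1) ^ 2 * Q ^ 2 / c ^ 2 * a := by rw [ha]; ring
    _ ≤ _ := by gcongr

theorem volume_inv_smul_DeltaInf_inter_inv_smul_DeltaC_le {c : ℝ} (hc : 0 < c) (p q : ℕ+) :
    volume ((((p : ℕ) : ℝ)⁻¹ • DeltaInf) ∩ (((q : ℕ) : ℝ)⁻¹ • DeltaC c)) ≤
      ENNReal.ofReal (4 * (Real.exp 1) ^ 2) *
        (ENNReal.ofReal (((p : ℕ) : ℝ) ^ (-(3 / 2) : ℝ)) *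
          ENNReal.ofReal (((q : ℕ) : ℝ) ^ (-(3 / 2) : ℝ))) := by
  have hq0 : (0 : ℝ) < (q : ℕ) := by exact_mod_cast q.pos
  have hlen : c / (q : ℕ) - -(c / (q : ℕ)) = 2 * (c / (q : ℕ)) := by ring
  refine (measure_mono (inv_smul_DeltaInf_inter_inv_smul_DeltaC_subset hc p q)).trans_eq ?_
  rw [Measure.volume_eq_prod, Measure.prod_prod, Measure.volume_eq_prod, Measure.prod_prod,
    Real.volume_Icc, Real.volume_Icc, hlen, sub_zero, ← ENNReal.ofReal_mul (by positivity),
    ← ENNReal.ofReal_mul (by positivity), ← ENNReal.ofReal_mul (by positivity),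
    ← ENNReal.ofReal_mul (by positivity)]
  congr 1
  field_simp
  ring

theorem tsum_pnat_ofReal_rpow_neg_three_halves_ne_top :
    ∑' n : ℕ+, ENNReal.ofReal (((n : ℕ) : ℝ) ^ (-(3 / 2) : ℝ)) ≠ ⊤ := by
  have h : Summable fun n : ℕ => (n : ℝ) ^ (-(3 / 2) : ℝ) :=
    Real.summable_nat_rpow.mpr (by norm_num)
  exact (h.comp_injective PNat.coe_injective).tsum_ofReal_ne_top

theorem volume_DeltaInf_inter_DeltaC_pos {c : ℝ} (hc : c ∈ Set.Ioo (0 : ℝ) 1) :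
    0 < volume (DeltaInf ∩ DeltaC c) := by
  obtain ⟨hc0, hc1⟩ := hc
  have hec : (Real.exp 1)⁻¹ * c < c :=
    mul_lt_of_lt_one_left hc0 (inv_lt_one_of_one_lt₀ (Real.one_lt_exp_iff.mpr one_pos))
  have hec0 : 0 < (Real.exp 1)⁻¹ * c := by positivity
  have hsub : Set.Ioo ((Real.exp 1)⁻¹ * c) c ×ˢ Set.Ioo ((Real.exp 1)⁻¹ * c) c ×ˢ
      Set.Ioo (0 : ℝ) 1 ⊆ DeltaInf ∩ DeltaC c := by
    rintro ⟨x, z, y⟩ ⟨⟨hx1, hx2⟩, ⟨hz1, hz2⟩, hy1, hy2⟩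
    dsimp only at *
    have hx : 0 < x := hec0.trans hx1
    have hz : 0 < z := hec0.trans hz1
    have hxz : x * z ≤ 1 := mul_le_one₀ (by linarith) hz.le (by linarith)
    have h1 : x * z * y ≤ 1 := mul_le_one₀ hxz hy1.le hy2.le
    have h0 : 0 < x * z * y := by positivity
    simp only [DeltaInf, DeltaC, Set.mem_inter_iff, Set.mem_ofPred_eq, abs_mul, abs_of_pos hx,
      abs_of_pos hz]
    exact ⟨⟨h0, h1⟩, h0, h1, hx1, hx2.le, hz1, hz2.le⟩
  refine lt_of_lt_of_le ?_ (measure_mono hsub)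
  refine (isOpen_Ioo.prod (isOpen_Ioo.prod isOpen_Ioo)).measure_pos volume ?_
  exact (Set.nonempty_Ioo.mpr hec).prod
    ((Set.nonempty_Ioo.mpr hec).prod (Set.nonempty_Ioo.mpr one_pos))

theorem stmt2 (c : ℝ) (hc : c ∈ Set.Ioo (0:ℝ) 1) :
    (∑' p : ℕ+, ∑' q : ℕ+,
        volume ((((p : ℕ) : ℝ)⁻¹ • DeltaInf) ∩ (((q : ℕ) : ℝ)⁻¹ • DeltaC c))) ≠ ⊤ ∧
    0 < ∑' p : ℕ+, ∑' q : ℕ+,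
        volume ((((p : ℕ) : ℝ)⁻¹ • DeltaInf) ∩ (((q : ℕ) : ℝ)⁻¹ • DeltaC c)) := by
  constructor
  · refine ne_top_of_le_ne_top ?_ (ENNReal.tsum_le_tsum fun p => ENNReal.tsum_le_tsum fun q =>
      volume_inv_smul_DeltaInf_inter_inv_smul_DeltaC_le hc.1 p q)
    simp_rw [ENNReal.tsum_mul_left, ENNReal.tsum_mul_right]
    exact ENNReal.mul_ne_top ENNReal.ofReal_ne_top
      (ENNReal.mul_ne_top tsum_pnat_ofReal_rpow_neg_three_halves_ne_top
        tsum_pnat_ofReal_rpow_neg_three_halves_ne_top)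
  · refine lt_of_lt_of_le ?_
      ((ENNReal.le_tsum (1 : ℕ+)).trans (ENNReal.le_tsum (1 : ℕ+)))
    simpa using volume_DeltaInf_inter_DeltaC_pos hc

end
end

section
/- Fix c ∈ (0,1). There is a constant C_c > 0, depending only on c, such that for all 0 < a < b < 1 and T > 1: |Vol(Ω_{a,b,T}) − 2(ln T)²(b−a) − 4(ln T)·((b−a) + b·ln(b^{-1}c²) − a·ln(a^{-1}c²))| ≤ C_c, where Ω_{a,b,T} := {(x₁,x₂,y) ∈ ℝ³ : a < |x₁|·|x₂|·y < b, |x₁|,|x₂| ≤ c, 1 ≤ y < T}. -/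
open MeasureTheory

noncomputable section

/-- The domain `Ω_{a,b,T}` (with width parameter `c`). -/
def OmegaC (c a b T : ℝ) : Set (ℝ × ℝ × ℝ) :=
  {v | a < |v.1| * |v.2.1| * v.2.2 ∧ |v.1| * |v.2.1| * v.2.2 < b ∧
    |v.1| ≤ c ∧ |v.2.1| ≤ c ∧ 1 ≤ v.2.2 ∧ v.2.2 < T}

/-- The area of `{(x₁, x₂) ∈ (0, c]² : x₁ x₂ < t}`. -/
def hyperbolaArea (c t : ℝ) : ℝ :=
  min t (c ^ 2) * (1 + Real.log (c ^ 2 / min t (c ^ 2)))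

lemma volume_real_abs_lt_and_abs_le {c p : ℝ} (hc : 0 ≤ c) (hp : 0 ≤ p) :
    volume.real {x : ℝ | |x| < p ∧ |x| ≤ c} = 2 * min c p := by
  rcases le_or_gt p c with h | h
  · have : {x : ℝ | |x| < p ∧ |x| ≤ c} = Set.Ioo (-p) p := by
      ext x
      simp only [Set.mem_ofPred_eq, Set.mem_Ioo, ← abs_lt]
      exact ⟨fun hx => hx.1, fun hx => ⟨hx, hx.le.trans h⟩⟩
    rw [this, Real.volume_real_Ioo_of_le (by linarith), min_eq_right h]
    ring
  · have : {x : ℝ | |x| < p ∧ |x| ≤ c} = Set.Icc (-c) c := by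
      ext x
      simp only [Set.mem_ofPred_eq, Set.mem_Icc, ← abs_le]
      exact ⟨fun hx => hx.2, fun hx => ⟨hx.trans_lt h, hx⟩⟩
    rw [this, Real.volume_real_Icc_of_le (by linarith), min_eq_left h.le]
    ring

lemma volume_real_abs_mul_slice {a b c k : ℝ} (hc : 0 ≤ c) (ha : 0 < a) (hab : a < b)
    (hk : 0 ≤ k) :
    volume.real {x : ℝ | a < |x| * k ∧ |x| * k < b ∧ |x| ≤ c} =
      2 * (min c (b / k) - min c (a / k)) := by
  rcases hk.eq_or_lt with rfl | hk
  · have : {x : ℝ | a < |x| * 0 ∧ |x| * 0 < b ∧ |x| ≤ c} = ∅ := by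
      ext x
      simp [ha.not_gt]
    rw [this]
    simp
  · have hb : 0 < b := ha.trans hab
    have hset : {x : ℝ | a < |x| * k ∧ |x| * k < b ∧ |x| ≤ c} =
        {x : ℝ | |x| < b / k ∧ |x| ≤ c} \ Set.Icc (-min c (a / k)) (min c (a / k)) := by
      ext x
      rw [Set.mem_sdiff, Set.mem_Icc, ← abs_le]
      simp only [Set.mem_ofPred_eq, le_min_iff, lt_div_iff₀ hk, le_div_iff₀ hk]
      constructor
      · rintro ⟨h1, h2, h3⟩
        exact ⟨⟨h2, h3⟩, fun h => h1.not_ge h.2⟩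
      · rintro ⟨⟨h2, h3⟩, h1⟩
        exact ⟨lt_of_not_ge fun h => h1 ⟨h3, h⟩, h2, h3⟩
    have hsub : Set.Icc (-min c (a / k)) (min c (a / k)) ⊆ {x : ℝ | |x| < b / k ∧ |x| ≤ c} := by
      intro x hx
      rw [Set.mem_Icc, ← abs_le, le_min_iff] at hx
      exact ⟨hx.2.trans_lt (by gcongr), hx.1⟩
    have h0 : 0 ≤ min c (a / k) := le_min hc (by positivity)
    have hfin : volume {x : ℝ | |x| < b / k ∧ |x| ≤ c} ≠ ⊤ := by
      have hsub' : {x : ℝ | |x| < b / k ∧ |x| ≤ c} ⊆ Set.Icc (-c) c := fun x hx => abs_le.1 hx.2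
      exact measure_ne_top_of_subset hsub' isCompact_Icc.measure_lt_top.ne
    rw [hset, measureReal_sdiff hsub measurableSet_Icc hfin,
      volume_real_abs_lt_and_abs_le hc (by positivity), Real.volume_real_Icc_of_le (by linarith)]
    ring

lemma intervalIntegrable_min_div {c t p q : ℝ} (hc : 0 ≤ c) (ht : 0 ≤ t) (hp : 0 ≤ p)
    (hq : 0 ≤ q) :
    IntervalIntegrable (fun x => min c (t / x)) volume p q := by
  refine (intervalIntegrable_const (c := c)).mono_fun (by fun_prop) ?_
  refine (ae_restrict_iff' measurableSet_uIoc).2 (Filter.Eventually.of_forall fun x hx => ?_)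
  have hx0 : 0 ≤ x := (le_min hp hq).trans hx.1.le
  simp only [Real.norm_of_nonneg (le_min hc (div_nonneg ht hx0)), Real.norm_of_nonneg hc]
  exact min_le_left _ _

lemma integral_min_div {c t : ℝ} (hc : 0 < c) (ht : 0 < t) :
    ∫ x in (0:ℝ)..c, min c (t / x) = hyperbolaArea c t := by
  unfold hyperbolaArea
  rcases le_or_gt (c ^ 2) t with h | h
  · rw [min_eq_right h]
    have : ∫ x in (0:ℝ)..c, min c (t / x) = ∫ x in (0:ℝ)..c, c := by
      refine intervalIntegral.integral_congr_ae (Filter.Eventually.of_forall fun x hx => ?_)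
      rw [Set.uIoc_of_le hc.le] at hx
      refine min_eq_left ((le_div_iff₀ hx.1).2 ?_)
      nlinarith [hx.2]
    rw [this, div_self (by positivity)]
    simp [sq]
  · rw [min_eq_left h.le]
    have htc : t / c < c := (div_lt_iff₀ hc).2 (by nlinarith)
    have htc0 : 0 < t / c := by positivity
    rw [← intervalIntegral.integral_add_adjacent_intervals
      (intervalIntegrable_min_div hc.le ht.le le_rfl htc0.le)
      (intervalIntegrable_min_div hc.le ht.le htc0.le hc.le)]
    have h1 : ∫ x in (0:ℝ)..(t / c), min c (t / x) = ∫ x in (0:ℝ)..(t / c), c := by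
      refine intervalIntegral.integral_congr_ae (Filter.Eventually.of_forall fun x hx => ?_)
      rw [Set.uIoc_of_le htc0.le] at hx
      refine min_eq_left ((le_div_iff₀ hx.1).2 ?_)
      have := (le_div_iff₀ hc).1 hx.2
      linarith
    have h2 : ∫ x in (t / c)..c, min c (t / x) = ∫ x in (t / c)..c, t * x⁻¹ := by
      refine intervalIntegral.integral_congr_ae (Filter.Eventually.of_forall fun x hx => ?_)
      rw [Set.uIoc_of_le htc.le] at hx
      rw [← div_eq_mul_inv]
      refine min_eq_right ((div_le_iff₀ (htc0.trans hx.1)).2 ?_)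
      have := (div_lt_iff₀ hc).1 hx.1
      linarith
    rw [h1, h2, intervalIntegral.integral_const_mul, integral_inv_of_pos htc0 hc]
    have : c / (t / c) = c ^ 2 / t := by field_simp
    rw [this]
    simp
    field_simp

lemma integral_slice {a b c y : ℝ} (hc : 0 < c) (ha : 0 < a) (hab : a < b) (hy : 0 < y) :
    ∫ x : ℝ, (if |x| ≤ c then 2 * (min c (b / (|x| * y)) - min c (a / (|x| * y))) else 0) =
      4 * (hyperbolaArea c (b / y) - hyperbolaArea c (a / y)) := by
  have hb : 0 < b := ha.trans hab
  rw [integral_comp_abs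
    (f := fun r => if r ≤ c then 2 * (min c (b / (r * y)) - min c (a / (r * y))) else 0)]
  have h1 : ∫ r in Set.Ioi (0:ℝ),
      (if r ≤ c then 2 * (min c (b / (r * y)) - min c (a / (r * y))) else 0) =
      ∫ r in (0:ℝ)..c, 2 * (min c (b / y / r) - min c (a / y / r)) := by
    rw [intervalIntegral.integral_of_le hc.le, ← Set.Ioi_inter_Iic,
      ← setIntegral_indicator measurableSet_Iic]
    congr 1
    ext r
    simp only [Set.indicator_apply, Set.mem_Iic, div_div, mul_comm y]
  rw [h1, intervalIntegral.integral_const_mul, intervalIntegral.integral_sub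
    (intervalIntegrable_min_div hc.le (by positivity) le_rfl hc.le)
    (intervalIntegrable_min_div hc.le (by positivity) le_rfl hc.le),
    integral_min_div hc (by positivity), integral_min_div hc (by positivity)]
  ring

lemma measurableSet_OmegaC (c a b T : ℝ) : MeasurableSet (OmegaC c a b T) := by
  unfold OmegaC
  measurability

lemma volume_OmegaC_ne_top (c a b T : ℝ) : volume (OmegaC c a b T) ≠ ⊤ := by
  have hsub : OmegaC c a b T ⊆ Set.Icc (-c) c ×ˢ (Set.Icc (-c) c ×ˢ Set.Icc 1 T) := by
    rintro ⟨x, z, y⟩ ⟨-, -, h1, h2, h3, h4⟩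
    exact ⟨abs_le.1 h1, abs_le.1 h2, h3, h4.le⟩
  exact measure_ne_top_of_subset hsub
    (isCompact_Icc.prod (isCompact_Icc.prod isCompact_Icc)).measure_lt_top.ne

lemma volume_real_OmegaC {c a b T : ℝ} (hc : 0 < c) (ha : 0 < a) (hab : a < b) (hT : 1 ≤ T) :
    volume.real (OmegaC c a b T) =
      ∫ y in (1:ℝ)..T, 4 * (hyperbolaArea c (b / y) - hyperbolaArea c (a / y)) := by
  have hint : Integrable ((OmegaC c a b T).indicator (1 : ℝ × ℝ × ℝ → ℝ))
      ((volume : Measure ℝ).prod (volume : Measure (ℝ × ℝ))) :=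
    (integrable_indicator_iff (measurableSet_OmegaC c a b T)).2
      (integrableOn_const (volume_OmegaC_ne_top c a b T))
  have hslice : ∀ p : ℝ × ℝ, ∫ x, (OmegaC c a b T).indicator (1 : ℝ × ℝ × ℝ → ℝ) (x, p) =
      (Set.Ico 1 T).indicator (fun y => if |p.1| ≤ c then
        2 * (min c (b / (|p.1| * y)) - min c (a / (|p.1| * y))) else 0) p.2 := by
    rintro ⟨z, y⟩
    by_cases h : y ∈ Set.Ico 1 T ∧ |z| ≤ c
    · rw [Set.indicator_of_mem h.1, if_pos h.2,
        ← volume_real_abs_mul_slice hc.le ha hab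
          (mul_nonneg (abs_nonneg z) (zero_le_one.trans h.1.1)),
        ← integral_indicator_one (by measurability)]
      congr 1
      ext x
      simp only [Set.indicator_apply, OmegaC, Set.mem_ofPred_eq, mul_assoc, h.2, h.1.1, h.1.2,
        and_true, Pi.one_apply]
    · have h0 : ∀ x, (OmegaC c a b T).indicator (1 : ℝ × ℝ × ℝ → ℝ) (x, z, y) = 0 := fun x =>
        Set.indicator_of_notMem (fun hx => h ⟨hx.2.2.2.2, hx.2.2.2.1⟩) _
      simp only [h0, integral_zero, Set.indicator_apply]
      split_ifs with h1 h2
      · exact absurd ⟨h1, h2⟩ h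
      · rfl
      · rfl
  have hint' := hint.integral_prod_right
  simp only [hslice] at hint'
  rw [← integral_indicator_one (measurableSet_OmegaC c a b T), Measure.volume_eq_prod,
    integral_prod_symm _ hint]
  simp only [hslice]
  rw [Measure.volume_eq_prod, integral_prod_symm _ hint', intervalIntegral.integral_of_le hT,
    ← integral_Ico_eq_integral_Ioc, ← integral_indicator measurableSet_Ico]
  congr 1
  ext y
  by_cases hy : y ∈ Set.Ico 1 T
  · simp only [Set.indicator_of_mem hy]
    exact integral_slice hc ha hab (zero_lt_one.trans_le hy.1)
  · simp only [Set.indicator_of_notMem hy, integral_zero]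

lemma abs_hyperbolaArea_sub_le {c t : ℝ} (hc : 0 < c) (hc1 : c < 1) (ht : 0 < t) (ht1 : t ≤ 1) :
    |hyperbolaArea c t - t * (1 + Real.log (c ^ 2 / t))| ≤
      (2 - Real.log (c ^ 2)) / c ^ 4 * t ^ 2 := by
  have hc2 : c ^ 2 < 1 := by nlinarith
  have hlog : Real.log (c ^ 2) < 0 := Real.log_neg (by positivity) hc2
  unfold hyperbolaArea
  rcases le_or_gt t (c ^ 2) with h | h
  · rw [min_eq_left h, sub_self, abs_zero]
    have : 0 < 2 - Real.log (c ^ 2) := by linarith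
    positivity
  · rw [min_eq_right h.le, div_self (by positivity), Real.log_one,
      Real.log_div (by positivity) ht.ne']
    have hlt : Real.log t ≤ 0 := Real.log_nonpos ht.le ht1
    have hl : Real.log (c ^ 2) ≤ Real.log t := Real.log_le_log (by positivity) h.le
    have h1 : 2 - Real.log (c ^ 2) ≤ (2 - Real.log (c ^ 2)) / c ^ 4 * t ^ 2 := by
      rw [div_mul_eq_mul_div, le_div_iff₀ (by positivity)]
      have : c ^ 4 ≤ t ^ 2 := by
        calc c ^ 4 = (c ^ 2) ^ 2 := by ring
          _ ≤ t ^ 2 := by gcongr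
      gcongr
      linarith
    refine le_trans ?_ h1
    rw [abs_le]
    constructor <;> nlinarith [sq_nonneg c]

lemma pos_of_mem_uIcc_one {T y : ℝ} (hT : 1 ≤ T) (hy : y ∈ Set.uIcc 1 T) : 0 < y := by
  rw [Set.uIcc_of_le hT] at hy
  exact zero_lt_one.trans_le hy.1

lemma intervalIntegrable_main_term {c s T : ℝ} (hc : 0 < c) (hs : 0 < s) (hT : 1 ≤ T) :
    IntervalIntegrable (fun y => s / y * (1 + Real.log (c ^ 2 / (s / y)))) volume 1 T := by
  have hpos := fun y => pos_of_mem_uIcc_one (y := y) hT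
  refine ContinuousOn.intervalIntegrable ?_
  have h1 : ∀ y ∈ Set.uIcc 1 T, y ≠ 0 := fun y hy => (hpos y hy).ne'
  have h2 : ∀ y ∈ Set.uIcc 1 T, s / y ≠ 0 := fun y hy => (div_pos hs (hpos y hy)).ne'
  have h3 : ∀ y ∈ Set.uIcc 1 T, c ^ 2 / (s / y) ≠ 0 := fun y hy =>
    div_ne_zero (by positivity) (h2 y hy)
  fun_prop (disch := assumption)

lemma integral_main_term {c s T : ℝ} (hc : 0 < c) (hs : 0 < s) (hT : 1 ≤ T) :
    ∫ y in (1:ℝ)..T, s / y * (1 + Real.log (c ^ 2 / (s / y))) =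
      s * Real.log T ^ 2 / 2 + Real.log T * (s + s * Real.log (s⁻¹ * c ^ 2)) := by
  have hpos := fun y => pos_of_mem_uIcc_one (y := y) hT
  rw [intervalIntegral.integral_eq_sub_of_hasDerivAt
    (f := fun y => s * Real.log y ^ 2 / 2 + Real.log y * (s + s * Real.log (s⁻¹ * c ^ 2)))]
  · simp
  · intro y hy
    have hy0 := hpos y hy
    have hd := Real.hasDerivAt_log hy0.ne'
    refine (((hd.pow 2).const_mul s).div_const 2 |>.add (hd.mul_const _)).congr_deriv ?_
    have : c ^ 2 / (s / y) = s⁻¹ * c ^ 2 * y := by field_simp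
    rw [this, Real.log_mul (by positivity) hy0.ne']
    field_simp
    ring
  · exact intervalIntegrable_main_term hc hs hT

lemma intervalIntegrable_hyperbolaArea {c s T : ℝ} (hc : 0 < c) (hs : 0 < s) (hT : 1 ≤ T) :
    IntervalIntegrable (fun y => hyperbolaArea c (s / y)) volume 1 T := by
  have hpos := fun y => pos_of_mem_uIcc_one (y := y) hT
  refine ContinuousOn.intervalIntegrable ?_
  unfold hyperbolaArea
  have h1 : ∀ y ∈ Set.uIcc 1 T, y ≠ 0 := fun y hy => (hpos y hy).ne'
  have h2 : ∀ y ∈ Set.uIcc 1 T, min (s / y) (c ^ 2) ≠ 0 := fun y hy =>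
    (lt_min (div_pos hs (hpos y hy)) (by positivity)).ne'
  have h3 : ∀ y ∈ Set.uIcc 1 T, c ^ 2 / min (s / y) (c ^ 2) ≠ 0 := fun y hy =>
    div_ne_zero (by positivity) (h2 y hy)
  fun_prop (disch := assumption)

lemma abs_integral_hyperbolaArea_sub_le {c s T : ℝ} (hc : 0 < c) (hc1 : c < 1) (hs : 0 < s)
    (hs1 : s ≤ 1) (hT : 1 ≤ T) :
    |(∫ y in (1:ℝ)..T, hyperbolaArea c (s / y)) -
      (s * Real.log T ^ 2 / 2 + Real.log T * (s + s * Real.log (s⁻¹ * c ^ 2)))| ≤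
      (2 - Real.log (c ^ 2)) / c ^ 4 := by
  have hpos := fun y => pos_of_mem_uIcc_one (y := y) hT
  have hlog : Real.log (c ^ 2) < 0 := Real.log_neg (by positivity) (by nlinarith)
  set K := (2 - Real.log (c ^ 2)) / c ^ 4 with hKdef
  have hK : 0 ≤ K := div_nonneg (by linarith) (by positivity)
  rw [← integral_main_term hc hs hT, ← intervalIntegral.integral_sub
    (intervalIntegrable_hyperbolaArea hc hs hT) (intervalIntegrable_main_term hc hs hT)]
  have hgint : IntervalIntegrable (fun y : ℝ => K * (y ^ 2)⁻¹) volume 1 T := by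
    refine ContinuousOn.intervalIntegrable ?_
    have h1 : ∀ y ∈ Set.uIcc 1 T, y ^ 2 ≠ 0 := fun y hy => (pow_pos (hpos y hy) 2).ne'
    fun_prop (disch := assumption)
  have hg : ∫ y in (1:ℝ)..T, K * (y ^ 2)⁻¹ ≤ K := by
    rw [intervalIntegral.integral_eq_sub_of_hasDerivAt (f := fun y => K * -y⁻¹) ?_ hgint]
    · have : 0 ≤ K * T⁻¹ := mul_nonneg hK (by positivity)
      simp only [inv_one]
      linarith
    · intro y hy
      simpa using ((hasDerivAt_inv (hpos y hy).ne').neg).const_mul K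
  rw [← Real.norm_eq_abs]
  refine le_trans (intervalIntegral.norm_integral_le_of_norm_le hT
    (Filter.Eventually.of_forall fun y hy => ?_) hgint) hg
  have hy0 : 0 < y := zero_lt_one.trans hy.1
  refine (abs_hyperbolaArea_sub_le hc hc1 (div_pos hs hy0)
    ((div_le_one hy0).2 (hs1.trans hy.1.le))).trans ?_
  rw [← hKdef, div_pow, div_eq_mul_inv (s ^ 2)]
  gcongr
  exact mul_le_of_le_one_left (by positivity) (pow_le_one₀ hs.le hs1)

theorem stmt3 (c : ℝ) (hc : c ∈ Set.Ioo (0:ℝ) 1) :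
    ∃ C > 0, ∀ a b T : ℝ, 0 < a → a < b → b < 1 → 1 < T →
      |(volume (OmegaC c a b T)).toReal - 2 * Real.log T ^ 2 * (b - a) -
          4 * Real.log T *
            ((b - a) + b * Real.log (b⁻¹ * c ^ 2) - a * Real.log (a⁻¹ * c ^ 2))| ≤ C := by
  obtain ⟨hc0, hc1⟩ := hc
  have hlog : Real.log (c ^ 2) < 0 := Real.log_neg (by positivity) (by nlinarith)
  have hK : 0 < 2 - Real.log (c ^ 2) := by linarith
  refine ⟨8 * ((2 - Real.log (c ^ 2)) / c ^ 4), by positivity, fun a b T ha hab hb hT => ?_⟩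
  have hA := abs_le.1 (abs_integral_hyperbolaArea_sub_le hc0 hc1 ha (hab.trans hb).le hT.le)
  have hB := abs_le.1 (abs_integral_hyperbolaArea_sub_le hc0 hc1 (ha.trans hab) hb.le hT.le)
  rw [← measureReal_def, volume_real_OmegaC hc0 ha hab hT.le, intervalIntegral.integral_const_mul,
    intervalIntegral.integral_sub (intervalIntegrable_hyperbolaArea hc0 (ha.trans hab) hT.le)
      (intervalIntegrable_hyperbolaArea hc0 ha hT.le)]
  rw [abs_le]
  constructor <;> nlinarith [hA.1, hA.2, hB.1, hB.2]

end
end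

section
/- Let c > 0 and 0 < ξ < β, and let f : ℝ³ → [0,1] be measurable with support contained in [−c,c]² × [ξ,β]. There is a constant C_c, depending only on c, such that for every n = (n₁,n₂) ∈ ℤ_{≥0}²: ∫_{[0,1)²} Σ_{(p₁,p₂,q)∈ℤ³∖{0}} f(e^{n₁}(qα₁+p₁), e^{n₂}(qα₂+p₂), e^{-n₁-n₂}q) dα ≤ C_c·β. -/
open MeasureTheory
open scoped ENNReal

noncomputable section

/-- The unit box `[0,1)²`. -/
def box2 : Set (ℝ × ℝ) := Set.Ico (0:ℝ) 1 ×ˢ Set.Ico (0:ℝ) 1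

/-- The Siegel transform of `f` evaluated at the lattice `a(n)Λ_α`, computed in `ℝ≥0∞`:
`Σ_{(p₁,p₂,q) ∈ ℤ³∖{0}} f(e^{n₁}(qα₁+p₁), e^{n₂}(qα₂+p₂), e^{-n₁-n₂}q)`. -/
def siegelSum (f : ℝ × ℝ × ℝ → ℝ) (n : ℕ × ℕ) (α : ℝ × ℝ) : ℝ≥0∞ :=
  ∑' v : {w : ℤ × ℤ × ℤ // w ≠ 0},
    ENNReal.ofReal (f (Real.exp (n.1 : ℝ) * ((v.1.2.2 : ℝ) * α.1 + (v.1.1 : ℝ)),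
      Real.exp (n.2 : ℝ) * ((v.1.2.2 : ℝ) * α.2 + (v.1.2.1 : ℝ)),
      Real.exp (-(n.1 : ℝ) - (n.2 : ℝ)) * (v.1.2.2 : ℝ)))

open Set in
/-- The integrals of `g` over the unit intervals `[p, p + 1)` add up to the integral over `ℝ`. -/
lemma tsum_setLIntegral_Ico_intCast (g : ℝ → ℝ≥0∞) :
    ∑' p : ℤ, ∫⁻ x in Ico (p : ℝ) (p + 1), g x = ∫⁻ x, g x := by
  rw [← lintegral_iUnion (fun _ => measurableSet_Ico) (pairwise_disjoint_Ico_intCast ℝ),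
    iUnion_Ico_intCast, setLIntegral_univ]

open Set in
lemma setLIntegral_Ico_add_natCast (g : ℝ → ℝ≥0∞) (p : ℤ) (q : ℕ) :
    ∫⁻ x in Ico (p : ℝ) (p + q), g x =
      ∑ j ∈ Finset.range q, ∫⁻ x in Ico ((p + j : ℤ) : ℝ) ((p + j : ℤ) + 1), g x := by
  induction q with
  | zero => simp
  | succ q ih =>
    have hq : (p : ℝ) ≤ p + q := by simp
    have hq' : (p : ℝ) + q ≤ p + q + 1 := by simp
    rw [Finset.sum_range_succ, ← ih]
    push_cast
    rw [← add_assoc, ← Ico_union_Ico_eq_Ico hq hq',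
      lintegral_union measurableSet_Ico]
    exact Ico_disjoint_Ico_same

open Set in
/-- Every point lies in exactly `q` of the intervals `[p, p + q)`. -/
lemma tsum_setLIntegral_Ico_add_natCast (g : ℝ → ℝ≥0∞) (q : ℕ) :
    ∑' p : ℤ, ∫⁻ x in Ico (p : ℝ) (p + q), g x = q * ∫⁻ x, g x := by
  simp_rw [setLIntegral_Ico_add_natCast]
  rw [Summable.tsum_finsetSum fun _ _ => ENNReal.summable]
  have h (j : ℕ) : ∑' p : ℤ, ∫⁻ x in Ico ((p + j : ℤ) : ℝ) ((p + j : ℤ) + 1), g x =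
      ∫⁻ x, g x := by
    rw [← tsum_setLIntegral_Ico_intCast g]
    exact (Equiv.addRight (j : ℤ)).tsum_eq
      fun p : ℤ => ∫⁻ x in Ico (p : ℝ) (p + 1), g x
  simp_rw [h, Finset.sum_const, Finset.card_range, nsmul_eq_mul]

open Set in
lemma setLIntegral_comp_mul_add {g : ℝ → ℝ≥0∞} (hg : Measurable g) {q : ℝ} (hq : 0 < q) (p : ℝ) :
    ∫⁻ x in Ico (0 : ℝ) 1, g (q * x + p) =
      ENNReal.ofReal q⁻¹ * ∫⁻ x in Ico p (p + q), g x := by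
  have hind (x : ℝ) : (Ico (0 : ℝ) 1).indicator (fun x => g (q * x + p)) x =
      (Ico p (p + q)).indicator g (q * x + p) := by
    have hiff : x ∈ Ico (0 : ℝ) 1 ↔ q * x + p ∈ Ico p (p + q) := by
      simp only [mem_Ico, le_add_iff_nonneg_left, mul_nonneg_iff_of_pos_left hq]
      rw [add_comm p q, add_lt_add_iff_right, mul_lt_iff_lt_one_right hq]
    by_cases hx : x ∈ Ico (0 : ℝ) 1
    · rw [indicator_of_mem hx, indicator_of_mem (hiff.1 hx)]
    · rw [indicator_of_notMem hx, indicator_of_notMem (mt hiff.2 hx)]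
  have hG : Measurable ((Ico p (p + q)).indicator g) := hg.indicator measurableSet_Ico
  rw [← lintegral_indicator measurableSet_Ico, ← lintegral_indicator measurableSet_Ico]
  simp_rw [hind]
  rw [← lintegral_map (f := fun y => (Ico p (p + q)).indicator g (y + p)) (g := fun x => q * x)
    (by fun_prop) (by fun_prop), Real.map_volume_mul_left hq.ne', lintegral_smul_measure,
    lintegral_add_right_eq_self (fun y => (Ico p (p + q)).indicator g y), abs_of_pos (inv_pos.2 hq),
    smul_eq_mul]

/-- Unfolding: averaging the periodization of `g` along `x ↦ q x` gives the integral of `g`. -/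
lemma tsum_setLIntegral_comp_mul_add {g : ℝ → ℝ≥0∞} (hg : Measurable g) {q : ℤ} (hq : 0 < q) :
    ∑' p : ℤ, ∫⁻ x in Set.Ico (0 : ℝ) 1, g (q * x + p) = ∫⁻ x, g x := by
  lift q to ℕ using hq.le
  have hq' : (0 : ℝ) < q := by exact_mod_cast hq
  simp only [Int.cast_natCast]
  simp_rw [setLIntegral_comp_mul_add hg hq']
  rw [ENNReal.tsum_mul_left, tsum_setLIntegral_Ico_add_natCast, ← mul_assoc,
    ← ENNReal.ofReal_natCast, ← ENNReal.ofReal_mul (inv_nonneg.2 hq'.le),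
    inv_mul_cancel₀ hq'.ne', ENNReal.ofReal_one, one_mul]

lemma tsum_setLIntegral_box2_mul {g h : ℝ → ℝ≥0∞} (hg : Measurable g) (hh : Measurable h)
    {q : ℤ} (hq : 0 < q) :
    ∑' (p₁ : ℤ) (p₂ : ℤ), ∫⁻ α in box2, g (q * α.1 + p₁) * h (q * α.2 + p₂) =
      (∫⁻ x, g x) * ∫⁻ x, h x := by
  have hprod (p₁ p₂ : ℤ) : ∫⁻ α in box2, g (q * α.1 + p₁) * h (q * α.2 + p₂) =
      (∫⁻ x in Set.Ico (0 : ℝ) 1, g (q * x + p₁)) *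
        ∫⁻ x in Set.Ico (0 : ℝ) 1, h (q * x + p₂) := by
    rw [box2, Measure.volume_eq_prod, ← Measure.prod_restrict]
    exact lintegral_prod_mul (f := fun x => g (q * x + p₁)) (g := fun x => h (q * x + p₂))
      (by fun_prop) (by fun_prop)
  simp_rw [hprod, ENNReal.tsum_mul_left, ENNReal.tsum_mul_right,
    tsum_setLIntegral_comp_mul_add hh hq, tsum_setLIntegral_comp_mul_add hg hq]

/-- The mean value of the Siegel-type sum of a product function over `1 ≤ q ≤ N`. -/
lemma lintegral_box2_tsum {g h : ℝ → ℝ≥0∞} (hg : Measurable g) (hh : Measurable h) (N : ℕ) :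
    ∫⁻ α in box2, ∑' w : ℤ × ℤ × ℤ, (if w.2.2 ∈ Finset.Icc (1 : ℤ) N then
      g (w.2.2 * α.1 + w.1) * h (w.2.2 * α.2 + w.2.1) else 0) =
      N * ((∫⁻ x, g x) * ∫⁻ x, h x) := by
  have hite (w : ℤ × ℤ × ℤ) : ∫⁻ α in box2, (if w.2.2 ∈ Finset.Icc (1 : ℤ) N then
      g (w.2.2 * α.1 + w.1) * h (w.2.2 * α.2 + w.2.1) else 0) =
      if w.2.2 ∈ Finset.Icc (1 : ℤ) N then
        ∫⁻ α in box2, g (w.2.2 * α.1 + w.1) * h (w.2.2 * α.2 + w.2.1) else 0 := by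
    split_ifs <;> simp
  rw [lintegral_tsum fun w => by split_ifs <;> fun_prop]
  simp_rw [hite]
  rw [ENNReal.tsum_prod']
  simp_rw [ENNReal.tsum_prod']
  have hswap (p₁ : ℤ) := ENNReal.tsum_comm (f := fun p₂ q : ℤ =>
    if q ∈ Finset.Icc (1 : ℤ) N then
      ∫⁻ α in box2, g (q * α.1 + p₁) * h (q * α.2 + p₂) else 0)
  simp_rw [hswap]
  rw [ENNReal.tsum_comm]
  have hval (q : ℤ) : ∑' (p₁ : ℤ) (p₂ : ℤ), (if q ∈ Finset.Icc (1 : ℤ) N then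
      ∫⁻ α in box2, g (q * α.1 + p₁) * h (q * α.2 + p₂) else 0) =
      if q ∈ Finset.Icc (1 : ℤ) N then (∫⁻ x, g x) * ∫⁻ x, h x else 0 := by
    split_ifs with hq
    · exact tsum_setLIntegral_box2_mul hg hh (by have := (Finset.mem_Icc.1 hq).1; lia)
    · simp
  simp_rw [hval]
  rw [tsum_eq_sum (s := Finset.Icc (1 : ℤ) N) fun q hq => if_neg hq,
    Finset.sum_ite_of_true fun _ h => h]
  simp

lemma exp_mul_mem_Icc_iff (c t x : ℝ) :
    Real.exp t * x ∈ Set.Icc (-c) c ↔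
      x ∈ Set.Icc (-(c * Real.exp (-t))) (c * Real.exp (-t)) := by
  have ht := Real.exp_pos t
  rw [Set.mem_Icc, Set.mem_Icc, ← abs_le, ← abs_le, abs_mul, abs_of_pos ht, Real.exp_neg,
    ← div_eq_mul_inv, le_div_iff₀ ht, mul_comm]

/-- Each term of the Siegel sum is dominated by a product of indicators, and vanishes unless
`1 ≤ q ≤ β e^{n₁+n₂}`. -/
lemma ofReal_siegelTerm_le {c ξ β : ℝ} {f : ℝ × ℝ × ℝ → ℝ} (hξ : 0 < ξ)
    (hf01 : ∀ v, f v ∈ Set.Icc (0 : ℝ) 1)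
    (hsupp : Function.support f ⊆ Set.Icc (-c) c ×ˢ Set.Icc (-c) c ×ˢ Set.Icc ξ β)
    (n : ℕ × ℕ) (α : ℝ × ℝ) (w : ℤ × ℤ × ℤ) :
    ENNReal.ofReal (f (Real.exp (n.1 : ℝ) * ((w.2.2 : ℝ) * α.1 + (w.1 : ℝ)),
      Real.exp (n.2 : ℝ) * ((w.2.2 : ℝ) * α.2 + (w.2.1 : ℝ)),
      Real.exp (-(n.1 : ℝ) - (n.2 : ℝ)) * (w.2.2 : ℝ))) ≤
    if w.2.2 ∈ Finset.Icc (1 : ℤ) ⌊β * Real.exp (n.1 + n.2)⌋₊ then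
      (Set.Icc (-(c * Real.exp (-n.1))) (c * Real.exp (-n.1))).indicator 1
          (w.2.2 * α.1 + w.1) *
        (Set.Icc (-(c * Real.exp (-n.2))) (c * Real.exp (-n.2))).indicator 1
          (w.2.2 * α.2 + w.2.1) else 0 := by
  obtain ⟨p₁, p₂, q⟩ := w
  dsimp only
  by_cases hfv : f (Real.exp (n.1 : ℝ) * ((q : ℝ) * α.1 + (p₁ : ℝ)),
      Real.exp (n.2 : ℝ) * ((q : ℝ) * α.2 + (p₂ : ℝ)),
      Real.exp (-(n.1 : ℝ) - (n.2 : ℝ)) * (q : ℝ)) = 0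
  · rw [hfv, ENNReal.ofReal_zero]
    exact zero_le
  obtain ⟨h₁, h₂, h₃⟩ := hsupp hfv
  dsimp only at h₁ h₂ h₃
  have hq : q ∈ Finset.Icc (1 : ℤ) ⌊β * Real.exp (n.1 + n.2)⌋₊ := by
    have hqpos : (0 : ℝ) < q := pos_of_mul_pos_right (hξ.trans_le h₃.1) (Real.exp_pos _).le
    have hqle : (q : ℝ) ≤ β * Real.exp (n.1 + n.2) := by
      have := h₃.2
      rwa [← neg_add', Real.exp_neg, inv_mul_le_iff₀ (Real.exp_pos _), mul_comm] at this
    have hqpos' : 0 < q := by exact_mod_cast hqpos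
    refine Finset.mem_Icc.2 ⟨hqpos', ?_⟩
    lift q to ℕ using hqpos'.le
    exact Int.ofNat_le.2 (Nat.le_floor (by exact_mod_cast hqle))
  rw [if_pos hq, Set.indicator_of_mem ((exp_mul_mem_Icc_iff c _ _).1 h₁),
    Set.indicator_of_mem ((exp_mul_mem_Icc_iff c _ _).1 h₂), Pi.one_apply, Pi.one_apply, mul_one]
  exact ENNReal.ofReal_le_one.2 (hf01 _).2

theorem stmt6 (c : ℝ) (hc : 0 < c) :
    ∃ C > 0, ∀ (ξ β : ℝ) (f : ℝ × ℝ × ℝ → ℝ), 0 < ξ → ξ < β →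
      Measurable f → (∀ v, f v ∈ Set.Icc (0:ℝ) 1) →
      Function.support f ⊆ Set.Icc (-c) c ×ˢ Set.Icc (-c) c ×ˢ Set.Icc ξ β →
      ∀ n : ℕ × ℕ,
        (∫⁻ α in box2, siegelSum f n α) ≤ ENNReal.ofReal (C * β) := by
  refine ⟨4 * c ^ 2, by positivity, fun ξ β f hξ hξβ _ hf01 hsupp n => ?_⟩
  have hβ : 0 < β := hξ.trans hξβ
  let g (t : ℝ) : ℝ → ℝ≥0∞ :=
    (Set.Icc (-(c * Real.exp (-t))) (c * Real.exp (-t))).indicator 1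
  have hg (t : ℝ) : Measurable (g t) := measurable_one.indicator measurableSet_Icc
  have hgint (t : ℝ) : ∫⁻ x, g t x = ENNReal.ofReal (2 * c * Real.exp (-t)) := by
    rw [lintegral_indicator_one measurableSet_Icc, Real.volume_Icc]
    ring_nf
  let N : ℕ := ⌊β * Real.exp (n.1 + n.2)⌋₊
  let G (α : ℝ × ℝ) (w : ℤ × ℤ × ℤ) : ℝ≥0∞ :=
    if w.2.2 ∈ Finset.Icc (1 : ℤ) N then
      g n.1 (w.2.2 * α.1 + w.1) * g n.2 (w.2.2 * α.2 + w.2.1) else 0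
  have hsum (α : ℝ × ℝ) : siegelSum f n α ≤ ∑' v : {w : ℤ × ℤ × ℤ // w ≠ 0}, G α v.1 := by
    unfold siegelSum
    gcongr with v
    exact ofReal_siegelTerm_le hξ hf01 hsupp n α v.1
  calc ∫⁻ α in box2, siegelSum f n α
      ≤ ∫⁻ α in box2, ∑' w : ℤ × ℤ × ℤ, G α w :=
        lintegral_mono fun α => (hsum α).trans
          (ENNReal.tsum_comp_le_tsum_of_injective Subtype.val_injective (G α))
    _ = N * (ENNReal.ofReal (2 * c * Real.exp (-n.1)) *
          ENNReal.ofReal (2 * c * Real.exp (-n.2))) := by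
        rw [lintegral_box2_tsum (hg _) (hg _), hgint, hgint]
    _ = ENNReal.ofReal (N * (2 * c * Real.exp (-n.1) * (2 * c * Real.exp (-n.2)))) := by
        rw [← ENNReal.ofReal_mul (by positivity), ← ENNReal.ofReal_natCast,
          ← ENNReal.ofReal_mul (by positivity)]
    _ ≤ ENNReal.ofReal (4 * c ^ 2 * β) := by
        refine ENNReal.ofReal_le_ofReal ?_
        calc (N : ℝ) * (2 * c * Real.exp (-n.1) * (2 * c * Real.exp (-n.2)))
            ≤ β * Real.exp (n.1 + n.2) * (2 * c * Real.exp (-n.1) * (2 * c * Real.exp (-n.2))) := by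
              gcongr
              exact Nat.floor_le (by positivity)
          _ = 4 * c ^ 2 * β := by
              rw [Real.exp_add, Real.exp_neg, Real.exp_neg]
              field_simp
              ring

end
end

section
/- Let c > 0, 0 < ξ < β, and let f : ℝ³ → [0,1] be measurable with support contained in [−c,c]² × [ξ,β]. Assume that the function A(y) := ∫_{ℝ²} f(x₁,x₂,y) dx₁dx₂ is piecewise C¹ with discontinuities at no more than s points and satisfies |A| ≤ M and |A'| ≤ M' (at points of differentiability) for some M, M' > 0. Then there is a constant C depending only on s and β such that for every n = (n₁,n₂) ∈ ℤ_{≥0}²: |∫_{[0,1)²} Σ_{(p₁,p₂,q)∈ℤ³∖{0}} f(e^{n₁}(qα₁+p₁), e^{n₂}(qα₂+p₂), e^{-n₁-n₂}q) dα − ∫_{ℝ³} f(z) dz| ≤ C·(M+M')·e^{-n₁-n₂}. -/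
open MeasureTheory
open scoped ENNReal

noncomputable section

/-- Affine change of variables for the Lebesgue integral on the line. -/
lemma lintegral_comp_mul_add {a : ℝ} (ha : 0 < a) (b : ℝ) (g : ℝ → ℝ≥0∞) :
    ∫⁻ x, g (a * x + b) = ENNReal.ofReal a⁻¹ * ∫⁻ x, g x := by
  have hemb : MeasurableEmbedding (fun x : ℝ => a * x) :=
    (Homeomorph.mulLeft₀ a ha.ne').measurableEmbedding
  rw [← hemb.lintegral_map (fun y => g (y + b)), Real.map_volume_mul_left ha.ne',
    lintegral_smul_measure, lintegral_add_right_eq_self, abs_of_pos (inv_pos.2 ha), smul_eq_mul]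

/-- Each real number lies in exactly `q` of the intervals `[p, p + q)` with `p ∈ ℤ`. -/
lemma tsum_indicator_Ico_add_int {q : ℤ} (hq : 0 < q) (x : ℝ) (c : ℝ≥0∞) :
    ∑' p : ℤ, (Set.Ico (p : ℝ) (p + q)).indicator (fun _ => c) x = ENNReal.ofReal q * c := by
  have hmem : ∀ p : ℤ, p ∈ Finset.Ioc (⌊x⌋ - q) ⌊x⌋ ↔ x ∈ Set.Ico (p : ℝ) (p + q) := by
    intro p
    rw [Finset.mem_Ioc, Set.mem_Ico, Int.le_floor, sub_lt_iff_lt_add, Int.floor_lt]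
    push_cast
    exact and_comm
  rw [tsum_eq_sum (s := Finset.Ioc (⌊x⌋ - q) ⌊x⌋)
    (fun p hp => Set.indicator_of_notMem (fun h => hp ((hmem p).2 h)) _),
    Finset.sum_congr rfl (fun p hp => Set.indicator_of_mem ((hmem p).1 hp) _),
    Finset.sum_const, Int.card_Ioc, nsmul_eq_mul]
  congr 1
  rw [← ENNReal.ofReal_natCast]
  congr 1
  have : (((⌊x⌋ - (⌊x⌋ - q)).toNat : ℤ) : ℝ) = q := by
    congr 1
    omega
  exact_mod_cast this

/-- Unfolding over one unit interval. -/
lemma tsum_lintegral_Ico_comp {a : ℝ} (ha : 0 < a) {q : ℤ} (hq : 0 < q) {g : ℝ → ℝ≥0∞}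
    (hg : Measurable g) :
    ∑' p : ℤ, ∫⁻ x in Set.Ico (0 : ℝ) 1, g (a * (q * x + p)) = ENNReal.ofReal a⁻¹ * ∫⁻ x, g x := by
  have hq' : (0 : ℝ) < q := by exact_mod_cast hq
  have hstep : ∀ p : ℤ, ∫⁻ x in Set.Ico (0 : ℝ) 1, g (a * (q * x + p)) =
      ENNReal.ofReal (q : ℝ)⁻¹ *
        ∫⁻ y, (Set.Ico (p : ℝ) (p + q)).indicator (fun _ => g (a * y)) y := by
    intro p
    rw [← lintegral_comp_mul_add hq' p, ← lintegral_indicator measurableSet_Ico]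
    refine lintegral_congr fun x => ?_
    have hiff : x ∈ Set.Ico (0 : ℝ) 1 ↔ (q : ℝ) * x + p ∈ Set.Ico (p : ℝ) (p + q) := by
      simp only [Set.mem_Ico]
      refine and_congr ⟨fun h => by nlinarith, fun h => ?_⟩ ⟨fun h => by nlinarith, fun h => ?_⟩
      · by_contra! hx
        nlinarith
      · by_contra! hx
        nlinarith
    by_cases hx : x ∈ Set.Ico (0 : ℝ) 1
    · rw [Set.indicator_of_mem hx, Set.indicator_of_mem (hiff.1 hx)]
    · rw [Set.indicator_of_notMem hx, Set.indicator_of_notMem (fun h => hx (hiff.2 h))]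
  have hga : Measurable fun y => g (a * y) := hg.comp (measurable_const_mul a)
  have hmeas : ∀ p : ℤ, AEMeasurable
      (fun y => (Set.Ico (p : ℝ) (p + q)).indicator (fun _ => g (a * y)) y) := fun p =>
    (hga.indicator measurableSet_Ico : Measurable
      ((Set.Ico (p : ℝ) (p + q)).indicator fun y => g (a * y))).aemeasurable
  simp_rw [hstep]
  rw [ENNReal.tsum_mul_left, ← lintegral_tsum hmeas]
  simp_rw [tsum_indicator_Ico_add_int hq]
  rw [lintegral_const_mul _ hga, ← mul_assoc, ← ENNReal.ofReal_mul (inv_nonneg.2 hq'.le),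
    inv_mul_cancel₀ hq'.ne', ENNReal.ofReal_one, one_mul]
  simpa using lintegral_comp_mul_add ha 0 g

/-- Unfolding over the unit square. -/
lemma tsum_tsum_lintegral_box2_comp {a b : ℝ} (ha : 0 < a) (hb : 0 < b) {q : ℤ} (hq : 0 < q)
    {G : ℝ × ℝ → ℝ≥0∞} (hG : Measurable G) :
    ∑' p₁ : ℤ, ∑' p₂ : ℤ, ∫⁻ α in box2, G (a * (q * α.1 + p₁), b * (q * α.2 + p₂)) =
      ENNReal.ofReal a⁻¹ * ENNReal.ofReal b⁻¹ * ∫⁻ x, G x := by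
  have hinner : ∀ p₁ : ℤ,
      ∑' p₂ : ℤ, ∫⁻ α in box2, G (a * (q * α.1 + p₁), b * (q * α.2 + p₂)) =
      ∫⁻ x in Set.Ico (0 : ℝ) 1, ENNReal.ofReal b⁻¹ * ∫⁻ y, G (a * (q * x + p₁), y) := by
    intro p₁
    have hprod : ∀ p₂ : ℤ, ∫⁻ α in box2, G (a * (q * α.1 + p₁), b * (q * α.2 + p₂)) =
        ∫⁻ x in Set.Ico (0 : ℝ) 1, ∫⁻ y in Set.Ico (0 : ℝ) 1,
          G (a * (q * x + p₁), b * (q * y + p₂)) := by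
      intro p₂
      rw [box2, Measure.volume_eq_prod, ← Measure.prod_restrict, lintegral_prod]
      fun_prop
    simp_rw [hprod]
    rw [← lintegral_tsum]
    · refine lintegral_congr fun x => ?_
      exact tsum_lintegral_Ico_comp hb hq (g := fun y => G (a * (q * x + p₁), y)) (by fun_prop)
    · intro p₂
      refine Measurable.aemeasurable ?_
      refine Measurable.lintegral_prod_right'
        (f := fun z : ℝ × ℝ => G (a * (q * z.1 + p₁), b * (q * z.2 + p₂))) ?_
      fun_prop
  have hsec : Measurable fun x => ∫⁻ y, G (x, y) := hG.lintegral_prod_right'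
  simp_rw [hinner]
  rw [tsum_lintegral_Ico_comp ha hq (g := fun x => ENNReal.ofReal b⁻¹ * ∫⁻ y, G (x, y))
    (hsec.const_mul _), lintegral_const_mul _ hsec, Measure.volume_eq_prod,
    lintegral_prod _ hG.aemeasurable, mul_assoc]

/-- Right-endpoint Riemann sums of a bounded function that is differentiable, with bounded
derivative, off a finite set. -/
lemma abs_riemannSum_sub_integral_le {A : ℝ → ℝ} {M M' ε : ℝ} {D : Finset ℝ} (hε : 0 < ε)
    (hM' : 0 ≤ M') (hA : Integrable A)
    (hD : ∀ y ∉ (D : Set ℝ), DifferentiableAt ℝ A y ∧ |deriv A y| ≤ M')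
    (hM : ∀ y, |A y| ≤ M) (N : ℕ) :
    |∑ k ∈ Finset.range N, ε * A (ε * (k + 1)) - ∫ y in (0 : ℝ)..ε * N, A y| ≤
      N * (M' * ε * ε) + D.card * (2 * M * ε) := by
  classical
  have hM0 : 0 ≤ M := (abs_nonneg _).trans (hM 0)
  have hint : ∀ a b : ℝ, IntervalIntegrable A volume a b := fun a b => hA.intervalIntegrable
  have hadj := intervalIntegral.sum_integral_adjacent_intervals (f := A) (μ := volume)
    (a := fun k : ℕ => ε * k) (n := N) (fun k _ => hint _ _)
  simp only [Nat.cast_zero, mul_zero, Nat.cast_add, Nat.cast_one] at hadj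
  rw [← hadj, ← Finset.sum_sub_distrib]
  have hdiff : ∀ k : ℕ, ε * A (ε * (k + 1)) - ∫ y in ε * k..ε * (k + 1), A y =
      ∫ y in ε * k..ε * (k + 1), (A (ε * (k + 1)) - A y) := by
    intro k
    rw [intervalIntegral.integral_sub intervalIntegrable_const (hint _ _),
      intervalIntegral.integral_const, smul_eq_mul]
    ring
  have hlen : ∀ k : ℕ, |ε * ((k : ℝ) + 1) - ε * k| = ε := fun k => by
    rw [← mul_sub, add_sub_cancel_left, mul_one, abs_of_pos hε]
  have hle : ∀ k : ℕ, ε * (k : ℝ) ≤ ε * (k + 1) := fun k => by nlinarith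
  let I : ℕ → Set ℝ := fun k => Set.Ioc (ε * (k : ℝ)) (ε * (k + 1))
  have hterm : ∀ k : ℕ, |ε * A (ε * (k + 1)) - ∫ y in ε * k..ε * (k + 1), A y| ≤
      M' * ε * ε + ∑ d ∈ D, if d ∈ I k then 2 * M * ε else 0 := by
    intro k
    rw [hdiff]
    by_cases hk : ∃ d ∈ D, d ∈ I k
    · obtain ⟨d, hdD, hdk⟩ := hk
      have h1 := intervalIntegral.norm_integral_le_of_norm_le_const
        (a := ε * k) (b := ε * (k + 1)) (f := fun y => A (ε * (k + 1)) - A y) (C := 2 * M)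
        (fun y _ => (norm_sub_le _ _).trans (by
          have h2 := hM (ε * (k + 1))
          have h3 := hM y
          simp only [Real.norm_eq_abs]
          linarith))
      rw [hlen, Real.norm_eq_abs] at h1
      have h2 : (if d ∈ I k then 2 * M * ε else 0) ≤
          ∑ d ∈ D, if d ∈ I k then 2 * M * ε else 0 :=
        Finset.single_le_sum (f := fun d => if d ∈ I k then 2 * M * ε else 0)
          (fun i _ => by split_ifs <;> positivity) hdD
      rw [if_pos hdk] at h2
      have : 0 ≤ M' * ε * ε := by positivity
      linarith
    · push Not at hk
      have h1 := intervalIntegral.norm_integral_le_of_norm_le_const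
        (a := ε * k) (b := ε * (k + 1)) (f := fun y => A (ε * (k + 1)) - A y) (C := M' * ε)
        (fun y hy => by
          rw [Set.uIoc_of_le (hle k)] at hy
          have hgood : ∀ x ∈ I k, x ∉ (D : Set ℝ) := fun x hx hxD => hk x hxD hx
          refine (Convex.norm_image_sub_le_of_norm_deriv_le (𝕜 := ℝ) (s := I k) (C := M')
            (fun x hx => (hD x (hgood x hx)).1) (fun x hx => (hD x (hgood x hx)).2)
            (convex_Ioc _ _) hy ⟨by nlinarith, le_rfl⟩).trans ?_
          refine mul_le_mul_of_nonneg_left ?_ hM'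
          rw [Real.norm_eq_abs, abs_of_nonneg (sub_nonneg.2 hy.2)]
          linarith [hy.1])
      rw [hlen, Real.norm_eq_abs] at h1
      have h2 : 0 ≤ ∑ d ∈ D, if d ∈ I k then 2 * M * ε else 0 :=
        Finset.sum_nonneg fun i _ => by split_ifs <;> positivity
      linarith
  refine (Finset.abs_sum_le_sum_abs _ _).trans ((Finset.sum_le_sum fun k _ => hterm k).trans ?_)
  rw [Finset.sum_add_distrib, Finset.sum_const, Finset.card_range, nsmul_eq_mul, Finset.sum_comm]
  refine add_le_add le_rfl ?_
  rw [← nsmul_eq_mul]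
  refine Finset.sum_le_card_nsmul _ _ _ fun d _ => ?_
  rw [← Finset.sum_filter, Finset.sum_const]
  have hcard : ((Finset.range N).filter fun k => d ∈ I k).card ≤ 1 := by
    refine Finset.card_le_one.2 fun i hi j hj => ?_
    have hi := (Finset.mem_filter.1 hi).2
    have hj := (Finset.mem_filter.1 hj).2
    have h1 : (i : ℝ) < j + 1 := lt_of_mul_lt_mul_left (hi.1.trans_le hj.2) hε.le
    have h2 : (j : ℝ) < i + 1 := lt_of_mul_lt_mul_left (hj.1.trans_le hi.2) hε.le
    norm_cast at h1 h2
    omega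
  calc _ ≤ 1 • (2 * M * ε) := nsmul_le_nsmul_left (by positivity) hcard
    _ = _ := one_nsmul _

/-- A bounded measurable function supported in a set of finite measure is integrable. -/
lemma integrable_of_support_subset_of_mem_Icc {X : Type*} [MeasurableSpace X] {μ : Measure X}
    {f : X → ℝ} {S : Set X} (hf : Measurable f) (hf01 : ∀ v, f v ∈ Set.Icc (0 : ℝ) 1)
    (hS : Function.support f ⊆ S) (hμ : μ S ≠ ⊤) : Integrable f μ := by
  rw [← integrableOn_iff_integrable_of_support_subset hS]
  refine Measure.integrableOn_of_bounded hμ hf.aestronglyMeasurable (M := 1)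
    (Filter.Eventually.of_forall fun v => ?_)
  rw [Real.norm_eq_abs, abs_of_nonneg (hf01 v).1]
  exact (hf01 v).2

/-- The mean of the Siegel transform over the unit square, expressed through the fibre integrals
of `f`. -/
lemma lintegral_siegelSum {f : ℝ × ℝ × ℝ → ℝ} (hf : Measurable f)
    (hzero : ∀ x₁ x₂ y, y ≤ 0 → f (x₁, x₂, y) = 0) (n : ℕ × ℕ) :
    ∫⁻ α in box2, siegelSum f n α =
      ∑' q : ℤ, ENNReal.ofReal (Real.exp (-(n.1 : ℝ) - (n.2 : ℝ))) *
        ∫⁻ x : ℝ × ℝ, ENNReal.ofReal (f (x.1, x.2, Real.exp (-(n.1 : ℝ) - (n.2 : ℝ)) * q)) := by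
  set ε := Real.exp (-(n.1 : ℝ) - (n.2 : ℝ)) with hε
  have hε0 : 0 < ε := Real.exp_pos _
  let F : ℤ × ℤ × ℤ → ℝ × ℝ → ℝ≥0∞ := fun w α =>
    ENNReal.ofReal (f (Real.exp (n.1 : ℝ) * ((w.2.2 : ℝ) * α.1 + (w.1 : ℝ)),
      Real.exp (n.2 : ℝ) * ((w.2.2 : ℝ) * α.2 + (w.2.1 : ℝ)), ε * (w.2.2 : ℝ)))
  have hsum : ∀ α, siegelSum f n α = ∑' w, F w α := by
    intro α
    refine tsum_subtype_eq_of_support_subset (f := fun w => F w α) (s := {w | w ≠ 0}) ?_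
    intro w hw h0
    refine hw ?_
    subst h0
    simp only [F, Prod.snd_zero, Int.cast_zero, mul_zero]
    rw [hzero _ _ _ le_rfl, ENNReal.ofReal_zero]
  have hF : ∀ w, Measurable (F w) := fun w => by
    simp only [F]
    fun_prop
  simp_rw [hsum]
  rw [lintegral_tsum fun w => (hF w).aemeasurable, ENNReal.tsum_prod']
  simp_rw [ENNReal.tsum_prod']
  have hswap : ∑' p₁ : ℤ, ∑' p₂ : ℤ, ∑' q : ℤ, ∫⁻ α in box2, F (p₁, p₂, q) α =
      ∑' q : ℤ, ∑' p₁ : ℤ, ∑' p₂ : ℤ, ∫⁻ α in box2, F (p₁, p₂, q) α := by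
    rw [ENNReal.tsum_comm (α := ℤ) (β := ℤ)
      (f := fun q p₁ => ∑' p₂ : ℤ, ∫⁻ α in box2, F (p₁, p₂, q) α)]
    exact tsum_congr fun p₁ => ENNReal.tsum_comm
  rw [hswap]
  refine tsum_congr fun q => ?_
  rcases le_or_gt q 0 with hq | hq
  · have hy : ε * (q : ℝ) ≤ 0 :=
      mul_nonpos_of_nonneg_of_nonpos hε0.le (by exact_mod_cast hq)
    simp [F, hzero _ _ _ hy]
  · have h := tsum_tsum_lintegral_box2_comp (Real.exp_pos (n.1 : ℝ)) (Real.exp_pos (n.2 : ℝ)) hq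
      (G := fun x => ENNReal.ofReal (f (x.1, x.2, ε * q))) (by fun_prop)
    rw [← ENNReal.ofReal_mul (by positivity), ← Real.exp_neg, ← Real.exp_neg, ← Real.exp_add,
      ← sub_eq_add_neg] at h
    exact h

theorem stmt7 (β : ℝ) (s : ℕ) :
    ∃ C > 0, ∀ (c ξ M M' : ℝ) (f : ℝ × ℝ × ℝ → ℝ) (A : ℝ → ℝ),
      0 < c → 0 < ξ → ξ < β → 0 < M → 0 < M' →
      Measurable f → (∀ v, f v ∈ Set.Icc (0:ℝ) 1) →
      Function.support f ⊆ Set.Icc (-c) c ×ˢ Set.Icc (-c) c ×ˢ Set.Icc ξ β →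
      (∀ y, A y = ∫ x : ℝ × ℝ, f (x.1, x.2, y)) →
      (∃ D : Finset ℝ, D.card ≤ s ∧
        ∀ y ∉ (D : Set ℝ), DifferentiableAt ℝ A y ∧ |deriv A y| ≤ M') →
      (∀ y, |A y| ≤ M) →
      ∀ n : ℕ × ℕ,
        |(∫⁻ α in box2, siegelSum f n α).toReal - ∫ z : ℝ × ℝ × ℝ, f z| ≤
          C * (M + M') * Real.exp (-(n.1 : ℝ) - (n.2 : ℝ)) := by
  refine ⟨|β| + 1 + 2 * s, by positivity, ?_⟩
  intro c ξ M M' f A _ hξ hξβ hM0 hM'0 hf hf01 hsupp hA hD hM n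
  obtain ⟨D, hDs, hD⟩ := hD
  have hβ : 0 < β := hξ.trans hξβ
  have hzero : ∀ x₁ x₂ y, y ∉ Set.Icc ξ β → f (x₁, x₂, y) = 0 := by
    intro x₁ x₂ y hy
    by_contra h
    exact hy (hsupp h).2.2
  have hnonpos : ∀ x₁ x₂ y, y ≤ 0 → f (x₁, x₂, y) = 0 := fun x₁ x₂ y hy =>
    hzero x₁ x₂ y fun h => by linarith [h.1]
  have hAzero : ∀ y, y ∉ Set.Icc ξ β → A y = 0 := by
    intro y hy
    rw [hA]
    simp [hzero _ _ y hy]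
  have hAnonneg : ∀ y, 0 ≤ A y := fun y => by
    rw [hA]
    exact integral_nonneg fun x => (hf01 _).1
  have hfint : Integrable f := by
    refine integrable_of_support_subset_of_mem_Icc hf hf01 hsupp ?_
    exact (isCompact_Icc.prod (isCompact_Icc.prod isCompact_Icc)).measure_lt_top.ne
  have hfassoc : Integrable (fun z : (ℝ × ℝ) × ℝ => f (z.1.1, z.1.2, z.2))
      ((volume : Measure (ℝ × ℝ)).prod (volume : Measure ℝ)) :=
    (volume_preserving_prodAssoc (α₁ := ℝ) (β₁ := ℝ) (γ₁ := ℝ)).integrable_comp_of_integrable hfint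
  have hAint : Integrable A := by
    rw [funext hA]
    exact hfassoc.integral_prod_right
  have hAf : ∫ z : ℝ × ℝ × ℝ, f z = ∫ y, A y := by
    rw [← (volume_preserving_prodAssoc (α₁ := ℝ) (β₁ := ℝ) (γ₁ := ℝ)).integral_comp
      MeasurableEquiv.prodAssoc.measurableEmbedding, Measure.volume_eq_prod]
    simp_rw [hA]
    exact integral_prod_symm _ hfassoc
  have hfibre : ∀ y, ∫⁻ x : ℝ × ℝ, ENNReal.ofReal (f (x.1, x.2, y)) = ENNReal.ofReal (A y) := by
    intro y
    rw [hA, ofReal_integral_eq_lintegral_ofReal _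
      (Filter.Eventually.of_forall fun x => (hf01 _).1)]
    refine integrable_of_support_subset_of_mem_Icc (by fun_prop) (fun x => hf01 _)
      (S := Set.Icc (-c) c ×ˢ Set.Icc (-c) c) (fun x hx => ?_)
      (isCompact_Icc.prod isCompact_Icc).measure_lt_top.ne
    exact ⟨(hsupp hx).1, (hsupp hx).2.1⟩
  rw [lintegral_siegelSum hf hnonpos]
  set ε := Real.exp (-(n.1 : ℝ) - (n.2 : ℝ)) with hε
  have hε0 : 0 < ε := Real.exp_pos _
  have hε1 : ε ≤ 1 := by
    refine Real.exp_le_one_iff.2 ?_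
    have h1 : (0 : ℝ) ≤ n.1 := Nat.cast_nonneg _
    have h2 : (0 : ℝ) ≤ n.2 := Nat.cast_nonneg _
    linarith
  set N := ⌈β / ε⌉₊ with hN
  have hβN : β ≤ ε * N := by
    rw [mul_comm]
    exact (div_le_iff₀ hε0).1 (Nat.le_ceil _)
  have hNβ : N * ε ≤ β + 1 := by
    have h := (Nat.ceil_lt_add_one (div_pos hβ hε0).le).le
    have h2 := mul_le_mul_of_nonneg_right h hε0.le
    rw [add_mul, div_mul_cancel₀ _ hε0.ne'] at h2
    linarith
  have htsum : (∑' q : ℤ, ENNReal.ofReal ε *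
      ∫⁻ x : ℝ × ℝ, ENNReal.ofReal (f (x.1, x.2, ε * q))).toReal =
      ∑ k ∈ Finset.range N, ε * A (ε * (k + 1)) := by
    simp_rw [hfibre, ← ENNReal.ofReal_mul hε0.le]
    rw [tsum_eq_sum (s := Finset.Ioc 0 (N : ℤ)), ← ENNReal.ofReal_sum_of_nonneg
      fun q _ => mul_nonneg hε0.le (hAnonneg _),
      ENNReal.toReal_ofReal (Finset.sum_nonneg fun q _ => mul_nonneg hε0.le (hAnonneg _))]
    · symm
      refine Finset.sum_bij (fun k _ => (k : ℤ) + 1) ?_ ?_ ?_ ?_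
      · intro k hk
        rw [Finset.mem_range] at hk
        rw [Finset.mem_Ioc]
        omega
      · intro i _ j _ hij
        omega
      · intro q hq
        rw [Finset.mem_Ioc] at hq
        exact ⟨(q - 1).toNat, by rw [Finset.mem_range]; omega, by omega⟩
      · intro k _
        push_cast
        rfl
    · intro q hq
      rw [hAzero, mul_zero, ENNReal.ofReal_zero]
      intro hy
      refine hq (Finset.mem_Ioc.2 ⟨?_, ?_⟩)
      · have : (0 : ℝ) < q := pos_of_mul_pos_right (hξ.trans_le hy.1) hε0.le
        exact_mod_cast this
      · have : (q : ℝ) ≤ N := le_of_mul_le_mul_left (hy.2.trans hβN) hε0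
        exact_mod_cast this
  have hAinterval : ∫ y, A y = ∫ y in (0 : ℝ)..ε * N, A y := by
    rw [intervalIntegral.integral_of_le (by positivity),
      setIntegral_eq_integral_of_forall_compl_eq_zero]
    intro y hy
    exact hAzero y fun h => hy ⟨hξ.trans_le h.1, h.2.trans hβN⟩
  rw [htsum, hAf, hAinterval]
  refine (abs_riemannSum_sub_integral_le hε0 hM'0.le hAint hD hM N).trans ?_
  have hs : (D.card : ℝ) ≤ s := by exact_mod_cast hDs
  calc (N : ℝ) * (M' * ε * ε) + D.card * (2 * M * ε)
      = N * ε * (M' * ε) + D.card * (2 * M * ε) := by ring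
    _ ≤ (β + 1) * (M' * ε) + s * (2 * M * ε) := by gcongr
    _ ≤ (β + 1) * ((M + M') * ε) + s * (2 * (M + M') * ε) := by
        gcongr <;> linarith
    _ = (|β| + 1 + 2 * s) * (M + M') * ε := by
        rw [abs_of_pos hβ]
        ring

end
end

section
/- There is an absolute constant C > 0 such that for every η ∈ (0,1) and every n = (n₁,n₂) ∈ ℤ_{≥0}², the Lebesgue measure of the set {α ∈ [0,1)² : s₁(a(n)Λ_α) ≤ η} is at most C·η³. Equivalently, the set in question is the set of α ∈ [0,1)² for which there exists (p₁,p₂,q) ∈ ℤ³∖{0} with |qα₁−p₁| ≤ η·e^{-n₁}, |qα₂−p₂| ≤ η·e^{-n₂}, and |q| ≤ η·e^{n₁+n₂}. -/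
open MeasureTheory
open scoped ENNReal

noncomputable section

/-- The closed `δ / q`-neighbourhood of the fractions `p / q` with `0 ≤ p ≤ q`. -/
def fractionNhd (q : ℕ) (δ : ℝ) : Set ℝ :=
  ⋃ p ∈ Finset.range (q + 1), Set.Icc (((p : ℝ) - δ) / q) (((p : ℝ) + δ) / q)

theorem volume_fractionNhd_le {q : ℕ} (hq : 0 < q) {δ : ℝ} (hδ : 0 ≤ δ) :
    volume (fractionNhd q δ) ≤ ENNReal.ofReal (4 * δ) := by
  have hq1 : (1 : ℝ) ≤ q := by exact_mod_cast hq
  calc volume (fractionNhd q δ)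
      ≤ ∑ p ∈ Finset.range (q + 1),
          volume (Set.Icc (((p : ℝ) - δ) / q) (((p : ℝ) + δ) / q)) :=
        measure_biUnion_finset_le _ _
    _ = ∑ _p ∈ Finset.range (q + 1), ENNReal.ofReal (2 * δ / q) := by
        refine Finset.sum_congr rfl fun p _ => ?_
        rw [Real.volume_Icc]
        congr 1
        ring
    _ = ENNReal.ofReal (((q + 1 : ℕ) : ℝ) * (2 * δ / q)) := by
        rw [Finset.sum_const, Finset.card_range, nsmul_eq_mul,
          ENNReal.ofReal_mul (Nat.cast_nonneg _), ENNReal.ofReal_natCast]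
    _ ≤ ENNReal.ofReal (4 * δ) := by
        refine ENNReal.ofReal_le_ofReal ?_
        rw [mul_div_assoc', div_le_iff₀ (by linarith)]
        push_cast
        nlinarith

theorem mem_fractionNhd {q : ℕ} (hq : 0 < q) {δ : ℝ} (hδ : δ < 1) {x : ℝ}
    (hx : x ∈ Set.Ico (0 : ℝ) 1) {p : ℤ} (hp : |(q : ℝ) * x - p| ≤ δ) :
    x ∈ fractionNhd q δ := by
  have hq0 : (0 : ℝ) < q := by exact_mod_cast hq
  obtain ⟨hx0, hx1⟩ := hx
  obtain ⟨hlo, hhi⟩ := abs_le.mp hp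
  have hp0 : -1 < p := by
    have : (-1 : ℝ) < p := by nlinarith
    exact_mod_cast this
  have hpq : p < q + 1 := by
    have : (p : ℝ) < q + 1 := by nlinarith
    exact_mod_cast this
  lift p to ℕ using by omega
  rw [Int.cast_natCast] at hlo hhi
  refine Set.mem_biUnion (x := p) (by simp; omega) ⟨?_, ?_⟩
  · rw [div_le_iff₀ hq0]
    linarith
  · rw [le_div_iff₀ hq0]
    linarith

/-- The integer coefficient `q` may be replaced by its absolute value. -/
theorem exists_abs_natAbs_mul_sub_le {q p : ℤ} {x δ : ℝ} (h : |(q : ℝ) * x - p| ≤ δ) :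
    ∃ p' : ℤ, |(q.natAbs : ℝ) * x - p'| ≤ δ := by
  rw [Nat.cast_natAbs]
  rcases abs_choice q with hq | hq
  · exact ⟨p, by rwa [hq]⟩
  · refine ⟨-p, ?_⟩
    rw [hq, ← abs_neg]
    push_cast
    convert h using 2
    ring

theorem stmt9 :
    ∃ C > 0, ∀ (η : ℝ), 0 < η → η < 1 → ∀ n : ℕ × ℕ,
      volume {α : ℝ × ℝ | α ∈ box2 ∧ ∃ v : ℤ × ℤ × ℤ, v ≠ 0 ∧
          |(v.2.2 : ℝ) * α.1 - (v.1 : ℝ)| ≤ η * Real.exp (-(n.1 : ℝ)) ∧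
          |(v.2.2 : ℝ) * α.2 - (v.2.1 : ℝ)| ≤ η * Real.exp (-(n.2 : ℝ)) ∧
          |(v.2.2 : ℝ)| ≤ η * Real.exp ((n.1 : ℝ) + (n.2 : ℝ))} ≤
        ENNReal.ofReal (C * η ^ 3) := by
  refine ⟨16, by norm_num, fun η hη0 hη1 n => ?_⟩
  have mul_exp_lt (k : ℕ) : η * Real.exp (-(k : ℝ)) < 1 :=
    mul_lt_one_of_nonneg_of_lt_one_left hη0.le hη1 (Real.exp_le_one_iff.mpr (by simp))
  set δ₁ := η * Real.exp (-(n.1 : ℝ)) with hδ₁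
  set δ₂ := η * Real.exp (-(n.2 : ℝ)) with hδ₂
  set Q := η * Real.exp ((n.1 : ℝ) + (n.2 : ℝ)) with hQ
  have hδ₁0 : 0 ≤ δ₁ := by positivity
  have hδ₂0 : 0 ≤ δ₂ := by positivity
  have hδ₁1 : δ₁ < 1 := mul_exp_lt n.1
  have hδ₂1 : δ₂ < 1 := mul_exp_lt n.2
  have hQ0 : 0 ≤ Q := by positivity
  have hprod : Q * (δ₁ * δ₂) = η ^ 3 := by
    have hexp : Real.exp ((n.1 : ℝ) + n.2) *
        (Real.exp (-(n.1 : ℝ)) * Real.exp (-(n.2 : ℝ))) = 1 := by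
      rw [← Real.exp_add, ← Real.exp_add, Real.exp_eq_one_iff]
      ring
    rw [hQ, hδ₁, hδ₂]
    linear_combination η ^ 3 * hexp
  calc _ ≤ volume (⋃ q ∈ Finset.Icc 1 ⌊Q⌋₊, fractionNhd q δ₁ ×ˢ fractionNhd q δ₂) := by
        refine measure_mono ?_
        rintro ⟨x, y⟩ ⟨⟨hx, hy⟩, ⟨p₁, p₂, q⟩, hv, h₁, h₂, h₃⟩
        dsimp only at hx hy h₁ h₂ h₃
        have hq : q ≠ 0 := by
          rintro rfl
          have eq_zero {p : ℤ} {x δ : ℝ} (hδ : δ < 1) (h : |((0 : ℤ) : ℝ) * x - p| ≤ δ) :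
              p = 0 := by
            rw [Int.cast_zero, zero_mul, zero_sub, abs_neg] at h
            exact Int.abs_lt_one_iff.mp (by exact_mod_cast h.trans_lt hδ)
          exact hv (by rw [eq_zero hδ₁1 h₁, eq_zero hδ₂1 h₂]; rfl)
        have hq0 : 0 < q.natAbs := Int.natAbs_pos.mpr hq
        obtain ⟨r₁, hr₁⟩ := exists_abs_natAbs_mul_sub_le h₁
        obtain ⟨r₂, hr₂⟩ := exists_abs_natAbs_mul_sub_le h₂
        refine Set.mem_biUnion (x := q.natAbs) ?_
          ⟨mem_fractionNhd hq0 hδ₁1 hx hr₁, mem_fractionNhd hq0 hδ₂1 hy hr₂⟩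
        refine Finset.mem_coe.mpr (Finset.mem_Icc.mpr ⟨hq0, Nat.le_floor ?_⟩)
        rwa [Nat.cast_natAbs, Int.cast_abs]
    _ ≤ ∑ q ∈ Finset.Icc 1 ⌊Q⌋₊, volume (fractionNhd q δ₁ ×ˢ fractionNhd q δ₂) :=
        measure_biUnion_finset_le _ _
    _ ≤ ∑ _q ∈ Finset.Icc 1 ⌊Q⌋₊, ENNReal.ofReal (16 * (δ₁ * δ₂)) := by
        refine Finset.sum_le_sum fun q hq => ?_
        have hq0 : 0 < q := (Finset.mem_Icc.mp hq).1
        rw [Measure.volume_eq_prod, Measure.prod_prod,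
          show 16 * (δ₁ * δ₂) = 4 * δ₁ * (4 * δ₂) by ring, ENNReal.ofReal_mul (by positivity)]
        exact mul_le_mul' (volume_fractionNhd_le hq0 hδ₁0) (volume_fractionNhd_le hq0 hδ₂0)
    _ = ENNReal.ofReal (⌊Q⌋₊ * (16 * (δ₁ * δ₂))) := by
        rw [Finset.sum_const, Nat.card_Icc, Nat.add_sub_cancel, nsmul_eq_mul,
          ENNReal.ofReal_mul (Nat.cast_nonneg _), ENNReal.ofReal_natCast]
    _ ≤ ENNReal.ofReal (16 * η ^ 3) := by
        refine ENNReal.ofReal_le_ofReal ?_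
        rw [← hprod, mul_left_comm]
        gcongr
        exact Nat.floor_le hQ0

end
end

section
/- There is an absolute constant C > 0 such that for every η ∈ (0,1) and every n = (n₁,n₂) ∈ ℤ_{≥0}², the Lebesgue measure of the set {α ∈ [0,1)² : s₁*(a(n)Λ_α) ≤ η} is at most C·(η³ + η²·e^{-min(n₁,n₂)}). -/
open MeasureTheory
open scoped ENNReal

noncomputable section

/-- The lattice vector `(qα₁+p₁, qα₂+p₂, q)` of `Λ_α` attached to `(p₁,p₂,q) ∈ ℤ³`. -/
def latVec (α : ℝ × ℝ) (v : ℤ × ℤ × ℤ) : ℝ × ℝ × ℝ :=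
  ((v.2.2 : ℝ) * α.1 + (v.1 : ℝ), (v.2.2 : ℝ) * α.2 + (v.2.1 : ℝ), (v.2.2 : ℝ))

/-- The diagonal map `a(t)(x₁,x₂,y) = (e^{t₁}x₁, e^{t₂}x₂, e^{-t₁-t₂}y)`. -/
def aMap (t : ℝ × ℝ) (x : ℝ × ℝ × ℝ) : ℝ × ℝ × ℝ :=
  (Real.exp t.1 * x.1, Real.exp t.2 * x.2.1, Real.exp (-t.1 - t.2) * x.2.2)

/-- The sup-norm of the wedge `u ∧ v` of two vectors of `ℝ³`. -/
def wedgeNorm (u v : ℝ × ℝ × ℝ) : ℝ :=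
  max |u.1 * v.2.1 - u.2.1 * v.1|
    (max |u.1 * v.2.2 - u.2.2 * v.1| |u.2.1 * v.2.2 - u.2.2 * v.2.1|)

/-- The points `x ∈ [0,1)` for which `b * x - c` is within `δ` of an integer have measure `O(δ)`,
uniformly in the nonzero integer `b` and in `c`. -/
lemma volume_near_integer_le (b : ℤ) (hb : b ≠ 0) (c δ : ℝ) (hδ : 0 ≤ δ) (hδ1 : δ ≤ 1) :
    volume {x : ℝ | x ∈ Set.Ico (0:ℝ) 1 ∧ ∃ d : ℤ, |(d : ℝ) - b * x + c| ≤ δ} ≤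
      ENNReal.ofReal (10 * δ) := by
  have hB : (1:ℝ) ≤ |(b:ℝ)| := by exact_mod_cast Int.one_le_abs hb
  have hb0 : (b:ℝ) ≠ 0 := by exact_mod_cast hb
  set F : Finset ℤ := Finset.Icc ⌈-|(b:ℝ)| - c - 1⌉ ⌊|(b:ℝ)| - c + 1⌋ with hF
  have hsub : {x : ℝ | x ∈ Set.Ico (0:ℝ) 1 ∧ ∃ d : ℤ, |(d : ℝ) - b * x + c| ≤ δ} ⊆
      ⋃ d ∈ F, Metric.closedBall (((d:ℝ) + c) / b) (δ / |(b:ℝ)|) := by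
    rintro x ⟨⟨hx0, hx1⟩, d, hd⟩
    have hbx : |(b:ℝ) * x| ≤ |(b:ℝ)| := by
      rw [abs_mul, abs_of_nonneg hx0]
      nlinarith
    have hbx' := abs_le.1 hbx
    have hd' := abs_le.1 hd
    simp only [Set.mem_iUnion]
    refine ⟨d, ?_, ?_⟩
    · rw [hF, Finset.mem_Icc, Int.ceil_le, Int.le_floor]
      constructor <;> linarith
    · rw [Metric.mem_closedBall, Real.dist_eq, le_div_iff₀ (by linarith), ← abs_mul]
      have h : (x - ((d:ℝ) + c) / b) * b = -((d : ℝ) - b * x + c) := by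
        field_simp
        ring
      rwa [h, abs_neg]
  have hcard : (F.card : ℝ) ≤ 5 * |(b:ℝ)| := by
    rw [hF, Int.card_Icc]
    have h1 := Int.le_ceil (-|(b:ℝ)| - c - 1)
    have h2 := Int.floor_le (|(b:ℝ)| - c + 1)
    set m := ⌈-|(b:ℝ)| - c - 1⌉
    set M := ⌊|(b:ℝ)| - c + 1⌋
    have h3 : (((M + 1 - m).toNat : ℤ) : ℝ) ≤ 5 * |(b:ℝ)| := by
      rw [Int.toNat_eq_max]
      push_cast
      apply max_le <;> linarith
    exact_mod_cast h3
  calc _ ≤ volume (⋃ d ∈ F, Metric.closedBall (((d:ℝ) + c) / b) (δ / |(b:ℝ)|)) :=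
        measure_mono hsub
    _ ≤ ∑ d ∈ F, volume (Metric.closedBall (((d:ℝ) + c) / b) (δ / |(b:ℝ)|)) :=
        measure_biUnion_finset_le _ _
    _ = ENNReal.ofReal (F.card * (2 * (δ / |(b:ℝ)|))) := by
        simp only [Real.volume_closedBall, Finset.sum_const, nsmul_eq_mul]
        rw [ENNReal.ofReal_mul (Nat.cast_nonneg _), ENNReal.ofReal_natCast]
    _ ≤ ENNReal.ofReal (10 * δ) := by
        apply ENNReal.ofReal_le_ofReal
        calc (F.card : ℝ) * (2 * (δ / |(b:ℝ)|)) ≤ 5 * |(b:ℝ)| * (2 * (δ / |(b:ℝ)|)) := by gcongr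
          _ = 10 * δ := by
            field_simp
            ring

/-- The points of the unit box at which the integral form `-b α₁ + a α₂` is within `δ` of an
integer. -/
def nearIntegerSet (δ : ℝ) (a b : ℤ) : Set (ℝ × ℝ) :=
  {α | α ∈ box2 ∧ ∃ d : ℤ, |(d : ℝ) - b * α.1 + a * α.2| ≤ δ}

lemma measurableSet_nearIntegerSet (δ : ℝ) (a b : ℤ) : MeasurableSet (nearIntegerSet δ a b) := by
  have h : nearIntegerSet δ a b =
      box2 ∩ ⋃ d : ℤ, {α : ℝ × ℝ | |(d : ℝ) - b * α.1 + a * α.2| ≤ δ} := by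
    ext α
    simp [nearIntegerSet]
  rw [h]
  refine (measurableSet_Ico.prod measurableSet_Ico).inter (MeasurableSet.iUnion fun d => ?_)
  exact measurableSet_le (by fun_prop) (by fun_prop)

lemma lintegral_le_of_le_on_Ico (f : ℝ → ℝ≥0∞) (c : ℝ≥0∞) (h : ∀ x ∈ Set.Ico (0:ℝ) 1, f x ≤ c)
    (h0 : ∀ x ∉ Set.Ico (0:ℝ) 1, f x = 0) : ∫⁻ x, f x ≤ c := by
  calc ∫⁻ x, f x ≤ ∫⁻ x, (Set.Ico (0:ℝ) 1).indicator (fun _ => c) x := by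
        refine lintegral_mono fun x => ?_
        by_cases hx : x ∈ Set.Ico (0:ℝ) 1
        · simpa only [Set.indicator_of_mem hx] using h x hx
        · simp only [h0 x hx, zero_le]
    _ = c := by
        rw [lintegral_indicator_const measurableSet_Ico]
        simp

lemma volume_nearIntegerSet_le (δ : ℝ) (hδ : 0 ≤ δ) (hδ1 : δ ≤ 1) (a b : ℤ)
    (hab : a ≠ 0 ∨ b ≠ 0) : volume (nearIntegerSet δ a b) ≤ ENNReal.ofReal (10 * δ) := by
  have hS := measurableSet_nearIntegerSet δ a b
  rw [Measure.volume_eq_prod]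
  rcases hab with ha | hb
  · rw [Measure.prod_apply hS]
    refine lintegral_le_of_le_on_Ico _ _ (fun x _ => ?_) (fun x hx => ?_)
    · refine (measure_mono ?_).trans
        (volume_near_integer_le (-a) (neg_ne_zero.2 ha) (-(b * x)) δ hδ hδ1)
      rintro y ⟨⟨_, hy⟩, d, hd⟩
      refine ⟨hy, d, ?_⟩
      convert hd using 2
      push_cast
      ring
    · convert measure_empty (μ := (volume : Measure ℝ))
      ext y
      simp only [Set.mem_preimage, Set.mem_empty_iff_false, iff_false]
      exact fun h => hx h.1.1
  · rw [Measure.prod_apply_symm hS]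
    refine lintegral_le_of_le_on_Ico _ _ (fun y _ => ?_) (fun y hy => ?_)
    · refine (measure_mono ?_).trans (volume_near_integer_le b hb (a * y) δ hδ hδ1)
      rintro x ⟨⟨hx, _⟩, d, hd⟩
      exact ⟨hx, d, hd⟩
    · convert measure_empty (μ := (volume : Measure ℝ))
      ext x
      simp only [Set.mem_preimage, Set.mem_empty_iff_false, iff_false]
      exact fun h => hy h.1.2

/-- The wedge of two vectors of `a(t)Λ_α` in terms of the integral wedge. -/
lemma wedgeNorm_aMap_latVec (t α : ℝ × ℝ) (v v' : ℤ × ℤ × ℤ) :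
    wedgeNorm (aMap t (latVec α v)) (aMap t (latVec α v')) =
      max (Real.exp (t.1 + t.2) *
          |((v.1 * v'.2.1 - v.2.1 * v'.1 : ℤ) : ℝ)
            - ((v.2.1 * v'.2.2 - v.2.2 * v'.2.1 : ℤ) : ℝ) * α.1
            + ((v.1 * v'.2.2 - v.2.2 * v'.1 : ℤ) : ℝ) * α.2|)
        (max (Real.exp (-t.2) * |((v.1 * v'.2.2 - v.2.2 * v'.1 : ℤ) : ℝ)|)
          (Real.exp (-t.1) * |((v.2.1 * v'.2.2 - v.2.2 * v'.2.1 : ℤ) : ℝ)|)) := by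
  have h1 : Real.exp (-t.2) = Real.exp t.1 * Real.exp (-t.1 - t.2) := by
    rw [← Real.exp_add]
    ring_nf
  have h2 : Real.exp (-t.1) = Real.exp t.2 * Real.exp (-t.1 - t.2) := by
    rw [← Real.exp_add]
    ring_nf
  have habs : ∀ s x : ℝ, Real.exp s * |x| = |Real.exp s * x| := fun s x => by
    rw [abs_mul, Real.abs_exp]
  simp only [habs]
  rw [h1, h2, Real.exp_add]
  simp only [wedgeNorm, aMap, latVec]
  push_cast
  congr 1
  · congr 1
    ring
  · congr 1 <;> congr 1 <;> ring

/-- The number of nonzero integer points of a box is at most linear in each of its sides and in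
its area. -/
lemma card_box_erase_zero_le (X Y : ℝ) (hX : 0 ≤ X) (hY : 0 ≤ Y) :
    (((Finset.Icc (-⌊X⌋) ⌊X⌋ ×ˢ Finset.Icc (-⌊Y⌋) ⌊Y⌋).erase (0, 0)).card : ℝ) ≤
      4 * (X * Y) + 2 * X + 2 * Y := by
  have hx := Int.floor_nonneg.2 hX
  have hy := Int.floor_nonneg.2 hY
  have hx' := Int.floor_le X
  have hy' := Int.floor_le Y
  generalize ⌊X⌋ = x at *
  generalize ⌊Y⌋ = y at *
  lift x to ℕ using hx
  lift y to ℕ using hy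
  have hxc : (Finset.Icc (-(x:ℤ)) x).card = 2 * x + 1 := by
    rw [Int.card_Icc]
    lia
  have hyc : (Finset.Icc (-(y:ℤ)) y).card = 2 * y + 1 := by
    rw [Int.card_Icc]
    lia
  rw [Finset.card_erase_of_mem (by simp), Finset.card_product, hxc, hyc]
  have h : (2 * x + 1) * (2 * y + 1) - 1 = 4 * (x * y) + 2 * x + 2 * y := by
    apply Nat.sub_eq_of_eq_add
    ring
  rw [h]
  push_cast at *
  gcongr

theorem stmt10 :
    ∃ C > 0, ∀ (η : ℝ), 0 < η → η < 1 → ∀ n : ℕ × ℕ,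
      volume {α : ℝ × ℝ | α ∈ box2 ∧ ∃ v v' : ℤ × ℤ × ℤ,
          wedgeNorm (aMap ((n.1 : ℝ), (n.2 : ℝ)) (latVec α v))
              (aMap ((n.1 : ℝ), (n.2 : ℝ)) (latVec α v')) ≠ 0 ∧
          wedgeNorm (aMap ((n.1 : ℝ), (n.2 : ℝ)) (latVec α v))
              (aMap ((n.1 : ℝ), (n.2 : ℝ)) (latVec α v')) ≤ η} ≤
        ENNReal.ofReal (C * (η ^ 3 + η ^ 2 * Real.exp (-((min n.1 n.2 : ℕ) : ℝ)))) := by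
  refine ⟨40, by norm_num, fun η hη hη1 n => ?_⟩
  obtain ⟨n₁, n₂⟩ := n
  simp only [wedgeNorm_aMap_latVec]
  set δ : ℝ := η * Real.exp (-(n₁ + n₂))
  set X : ℝ := η * Real.exp n₂
  set Y : ℝ := η * Real.exp n₁
  have hδ0 : 0 ≤ δ := by positivity
  have hδ1 : δ < 1 := by
    have : Real.exp (-(n₁ + n₂ : ℝ)) ≤ 1 := Real.exp_le_one_iff.2 (by
      have : (0:ℝ) ≤ n₁ + n₂ := by positivity
      linarith)
    nlinarith
  have hexp : ∀ s x : ℝ, Real.exp s * x ≤ η ↔ x ≤ η * Real.exp (-s) := fun s x => by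
    rw [Real.exp_neg, ← div_eq_mul_inv, le_div_iff₀ (Real.exp_pos s), mul_comm]
  set F : Finset (ℤ × ℤ) := (Finset.Icc (-⌊X⌋) ⌊X⌋ ×ˢ Finset.Icc (-⌊Y⌋) ⌊Y⌋).erase (0, 0) with hF
  have hmem : ∀ (Z : ℝ) (k : ℤ), |(k:ℝ)| ≤ Z → k ∈ Finset.Icc (-⌊Z⌋) ⌊Z⌋ := fun Z k hk => by
    rw [Finset.mem_Icc, ← abs_le, Int.le_floor]
    exact_mod_cast hk
  calc _ ≤ volume (⋃ k ∈ F, nearIntegerSet δ k.1 k.2) := by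
        refine measure_mono ?_
        rintro α ⟨hα, v, v', hne, hle⟩
        generalize v.1 * v'.2.1 - v.2.1 * v'.1 = d at hne hle
        generalize v.2.1 * v'.2.2 - v.2.2 * v'.2.1 = b at hne hle
        generalize v.1 * v'.2.2 - v.2.2 * v'.1 = a at hne hle
        simp only [max_le_iff, hexp, neg_neg] at hle
        obtain ⟨h1, h2, h3⟩ := hle
        simp only [Set.mem_iUnion]
        refine ⟨(a, b), ?_, hα, d, h1⟩
        rw [hF, Finset.mem_erase, Finset.mem_product]
        refine ⟨fun h0 => hne ?_, hmem X a h2, hmem Y b h3⟩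
        obtain ⟨rfl, rfl⟩ := Prod.mk.inj h0
        have hd : |(d:ℝ)| < 1 := by
          refine lt_of_le_of_lt ?_ hδ1
          simpa only [Int.cast_zero, zero_mul, sub_zero, add_zero] using h1
        have hd0 : d = 0 := Int.abs_lt_one_iff.1 (by exact_mod_cast hd)
        simp [hd0]
    _ ≤ ∑ k ∈ F, volume (nearIntegerSet δ k.1 k.2) := measure_biUnion_finset_le _ _
    _ ≤ ∑ k ∈ F, ENNReal.ofReal (10 * δ) := by
        refine Finset.sum_le_sum fun k hk => volume_nearIntegerSet_le δ hδ0 hδ1.le _ _ ?_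
        have h := Finset.ne_of_mem_erase hk
        contrapose! h
        exact Prod.ext h.1 h.2
    _ = ENNReal.ofReal (F.card * (10 * δ)) := by
        rw [Finset.sum_const, nsmul_eq_mul, ENNReal.ofReal_mul (Nat.cast_nonneg _),
          ENNReal.ofReal_natCast]
    _ ≤ _ := by
        apply ENNReal.ofReal_le_ofReal
        have hXY : δ * (X * Y) = η ^ 3 := by
          have h : Real.exp (-(n₁ + n₂ : ℝ)) * (Real.exp n₂ * Real.exp n₁) = 1 := by
            rw [← Real.exp_add, ← Real.exp_add, ← Real.exp_zero]
            ring_nf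
          linear_combination η ^ 3 * h
        have hδX : δ * X ≤ η ^ 2 * Real.exp (-((min n₁ n₂ : ℕ) : ℝ)) := by
          have h : δ * X = η ^ 2 * Real.exp (-(n₁ : ℝ)) := by
            rw [show -(n₁ : ℝ) = -(n₁ + n₂ : ℝ) + n₂ by ring, Real.exp_add]
            ring
          rw [h]
          gcongr
          exact min_le_left _ _
        have hδY : δ * Y ≤ η ^ 2 * Real.exp (-((min n₁ n₂ : ℕ) : ℝ)) := by
          have h : δ * Y = η ^ 2 * Real.exp (-(n₂ : ℝ)) := by
            rw [show -(n₂ : ℝ) = -(n₁ + n₂ : ℝ) + n₁ by ring, Real.exp_add]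
            ring
          rw [h]
          gcongr
          exact min_le_right _ _
        have hcard := card_box_erase_zero_le X Y (by positivity) (by positivity)
        calc (F.card : ℝ) * (10 * δ) ≤ (4 * (X * Y) + 2 * X + 2 * Y) * (10 * δ) := by gcongr
          _ = 40 * (δ * (X * Y)) + 20 * (δ * X) + 20 * (δ * Y) := by ring
          _ ≤ _ := by linarith

end
end

section
/- Let c > 0 and 0 < ξ < β ≤ 1, and let f : ℝ³ → [0,1] be measurable with support contained in [−c,c]² × [ξ,β]. There is a constant C_c, depending only on c, such that for every n = (n₁,n₂) ∈ ℤ_{≥0}²: ∫_{[0,1)²} (Σ_{(p₁,p₂,q)∈ℤ³∖{0}} f(e^{n₁}(qα₁+p₁), e^{n₂}(qα₂+p₂), e^{-n₁-n₂}q))² dα ≤ C_c·β·max(1, ln(β/ξ))²·max(1, max(n₁,n₂)·e^{-min(n₁,n₂)}). -/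
open MeasureTheory
open scoped ENNReal

noncomputable section

/-- Summing a nonnegative function over all divisors of all `q ≤ K`. -/
lemma sum_Ioc_sum_divisors_le (u : ℕ → ℝ) (hu : ∀ d, 0 ≤ u d) (K : ℕ) :
    ∑ q ∈ Finset.Ioc 0 K, ∑ d ∈ q.divisors, u d ≤ K * ∑ d ∈ Finset.Ioc 0 K, u d / d := by
  have hdiv : ∀ q ∈ Finset.Ioc 0 K,
      ∑ d ∈ q.divisors, u d = ∑ d ∈ Finset.Ioc 0 K, if d ∣ q then u d else 0 := by
    intro q hq
    rw [← Finset.sum_filter]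
    refine Finset.sum_congr ?_ fun _ _ => rfl
    ext d
    simp only [Finset.mem_Ioc] at hq
    simp only [Nat.mem_divisors, Finset.mem_filter, Finset.mem_Ioc]
    constructor
    · rintro ⟨h, -⟩
      exact ⟨⟨Nat.pos_of_dvd_of_pos h hq.1, (Nat.le_of_dvd hq.1 h).trans hq.2⟩, h⟩
    · rintro ⟨-, h⟩
      exact ⟨h, hq.1.ne'⟩
  rw [Finset.sum_congr rfl hdiv, Finset.sum_comm, Finset.mul_sum]
  refine Finset.sum_le_sum fun d _ => ?_
  rw [← Finset.sum_filter, Finset.sum_const, Nat.Ioc_filter_dvd_card_eq_div, nsmul_eq_mul]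
  calc ((K / d : ℕ) : ℝ) * u d ≤ (K / d : ℝ) * u d :=
        mul_le_mul_of_nonneg_right Nat.cast_div_le (hu d)
    _ = K * (u d / d) := by ring

lemma sum_gcd_div_pow_le (q k : ℕ) (hq : 0 < q) :
    ∑ r ∈ Finset.Ioc 0 q, ((q.gcd r : ℝ) / q) ^ (k + 1) ≤ ∑ d ∈ q.divisors, ((1 : ℝ) / d) ^ k := by
  have hq' : (0 : ℝ) < q := by exact_mod_cast hq
  calc ∑ r ∈ Finset.Ioc 0 q, ((q.gcd r : ℝ) / q) ^ (k + 1)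
      ≤ ∑ r ∈ Finset.Ioc 0 q, ∑ d ∈ q.divisors,
          if d ∣ r then ((d : ℝ) / q) ^ (k + 1) else 0 := by
        refine Finset.sum_le_sum fun r _ => ?_
        have h := Finset.single_le_sum
          (f := fun d : ℕ => if d ∣ r then ((d : ℝ) / q) ^ (k + 1) else 0) (s := q.divisors)
          (fun d _ => by positivity)
          (Nat.mem_divisors.2 ⟨Nat.gcd_dvd_left q r, hq.ne'⟩)
        simpa [Nat.gcd_dvd_right] using h
    _ = ∑ d ∈ q.divisors, ((d : ℝ) / q) ^ k := by
        rw [Finset.sum_comm]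
        refine Finset.sum_congr rfl fun d hd => ?_
        have hdq := Nat.dvd_of_mem_divisors hd
        have hd0 : (d : ℝ) ≠ 0 := by exact_mod_cast (Nat.pos_of_mem_divisors hd).ne'
        rw [← Finset.sum_filter, Finset.sum_const, Nat.Ioc_filter_dvd_card_eq_div, nsmul_eq_mul,
          Nat.cast_div hdq hd0, pow_succ]
        field_simp
    _ = ∑ d ∈ q.divisors, ((1 : ℝ) / d) ^ k := by
        rw [← Nat.sum_div_divisors q]
        refine Finset.sum_congr rfl fun d hd => ?_
        have hd0 : (d : ℝ) ≠ 0 := by exact_mod_cast (Nat.pos_of_mem_divisors hd).ne'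
        rw [Nat.cast_div (Nat.dvd_of_mem_divisors hd) hd0]
        congr 1
        field_simp

/-- The `k`-th power moment of `gcd(q,r) / max(q,r)` over the square `[1,K]²`. -/
lemma sum_gcd_div_max_pow_le (K k : ℕ) :
    ∑ q ∈ Finset.Ioc 0 K, ∑ r ∈ Finset.Ioc 0 K, ((q.gcd r : ℝ) / (max q r : ℕ)) ^ (k + 1) ≤
      2 * (K * ∑ d ∈ Finset.Ioc 0 K, ((1 : ℝ) / d) ^ (k + 1)) := by
  set h : ℕ → ℕ → ℝ := fun q r => if r ≤ q then ((q.gcd r : ℝ) / q) ^ (k + 1) else 0 with hh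
  have hnn : ∀ q r, 0 ≤ h q r := fun q r => by simp only [hh]; positivity
  have hle : ∀ q r, ((q.gcd r : ℝ) / (max q r : ℕ)) ^ (k + 1) ≤ h q r + h r q := by
    intro q r
    rcases le_total r q with hrq | hrq
    · rw [max_eq_left hrq]
      have : h q r = ((q.gcd r : ℝ) / q) ^ (k + 1) := by simp [hh, hrq]
      linarith [hnn r q]
    · rw [max_eq_right hrq]
      have : h r q = ((q.gcd r : ℝ) / r) ^ (k + 1) := by simp [hh, hrq, Nat.gcd_comm]
      linarith [hnn q r]
  have hsum : ∑ q ∈ Finset.Ioc 0 K, ∑ r ∈ Finset.Ioc 0 K, h q r ≤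
      K * ∑ d ∈ Finset.Ioc 0 K, ((1 : ℝ) / d) ^ (k + 1) := by
    calc ∑ q ∈ Finset.Ioc 0 K, ∑ r ∈ Finset.Ioc 0 K, h q r
        ≤ ∑ q ∈ Finset.Ioc 0 K, ∑ d ∈ q.divisors, ((1 : ℝ) / d) ^ k := by
          refine Finset.sum_le_sum fun q hq => ?_
          rw [Finset.mem_Ioc] at hq
          refine le_trans (le_of_eq ?_) (sum_gcd_div_pow_le q k hq.1)
          simp only [hh]
          rw [← Finset.sum_filter]
          refine Finset.sum_congr ?_ fun _ _ => rfl
          ext r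
          simp only [Finset.mem_filter, Finset.mem_Ioc]
          lia
      _ ≤ K * ∑ d ∈ Finset.Ioc 0 K, ((1 : ℝ) / d) ^ k / d :=
          sum_Ioc_sum_divisors_le _ (fun d => by positivity) K
      _ = _ := by
          congr 1
          refine Finset.sum_congr rfl fun d _ => ?_
          rw [pow_succ]; ring
  calc _ ≤ ∑ q ∈ Finset.Ioc 0 K, ∑ r ∈ Finset.Ioc 0 K, (h q r + h r q) :=
        Finset.sum_le_sum fun q _ => Finset.sum_le_sum fun r _ => hle q r
    _ = 2 * ∑ q ∈ Finset.Ioc 0 K, ∑ r ∈ Finset.Ioc 0 K, h q r := by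
        simp only [Finset.sum_add_distrib]
        rw [Finset.sum_comm (f := fun q r => h r q)]
        ring
    _ ≤ _ := by linarith

lemma sum_gcd_div_max_le (K : ℕ) :
    ∑ q ∈ Finset.Ioc 0 K, ∑ r ∈ Finset.Ioc 0 K, (q.gcd r : ℝ) / (max q r : ℕ) ≤
      2 * (K * (1 + Real.log K)) := by
  have h := sum_gcd_div_max_pow_le K 0
  simp only [zero_add, pow_one] at h
  refine h.trans ?_
  have h2 := harmonic_le_one_add_log K
  rw [harmonic_eq_sum_Icc] at h2
  push_cast at h2
  have : ∑ d ∈ Finset.Ioc 0 K, (1 : ℝ) / d ≤ 1 + Real.log K := by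
    refine le_trans (le_of_eq ?_) h2
    exact Finset.sum_congr (by ext; simp; lia) fun _ _ => by simp
  gcongr

lemma sum_sq_gcd_div_max_le (K : ℕ) :
    ∑ q ∈ Finset.Ioc 0 K, ∑ r ∈ Finset.Ioc 0 K, ((q.gcd r : ℝ) / (max q r : ℕ)) ^ 2 ≤
      4 * K := by
  refine (sum_gcd_div_max_pow_le K 1).trans ?_
  have h : ∀ m : ℕ, ∑ d ∈ Finset.Ioc 0 (m + 1), ((1 : ℝ) / d) ^ 2 ≤ 2 - 1 / (m + 1) := by
    intro m
    induction m with
    | zero => norm_num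
    | succ m ih =>
      rw [Finset.sum_Ioc_succ_top (by lia)]
      have : ((1 : ℝ) / ((m + 1 + 1 : ℕ) : ℝ)) ^ 2 ≤ 1 / (m + 1) - 1 / (m + 1 + 1) := by
        push_cast
        rw [div_sub_div _ _ (by positivity) (by positivity), div_pow, div_le_div_iff₀
          (by positivity) (by positivity)]
        nlinarith
      push_cast at *
      linarith
  have h2 : ∑ d ∈ Finset.Ioc 0 K, ((1 : ℝ) / d) ^ (1 + 1) ≤ 2 := by
    cases K with
    | zero => simp
    | succ m =>
      refine (h m).trans ?_
      have : (0 : ℝ) ≤ 1 / (m + 1) := by positivity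
      linarith
  have : (0 : ℝ) ≤ K := by positivity
  nlinarith

lemma card_Icc_ceil_floor_le {x y : ℝ} (h : x ≤ y) :
    ((Finset.Icc ⌈x⌉ ⌊y⌋).card : ℝ) ≤ y - x + 1 := by
  rw [Int.card_Icc]
  have h1 := Int.floor_le y
  have h2 := Int.le_ceil x
  rcases le_total 0 (⌊y⌋ + 1 - ⌈x⌉) with h0 | h0
  · have : (((⌊y⌋ + 1 - ⌈x⌉).toNat : ℤ) : ℝ) = ((⌊y⌋ + 1 - ⌈x⌉ : ℤ) : ℝ) := by
      rw [Int.toNat_of_nonneg h0]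
    push_cast at this
    rw [this]
    linarith
  · rw [Int.toNat_of_nonpos h0]
    push_cast
    linarith

lemma tsum_le_card_mul {ι κ : Type*} (h : ι → ℝ≥0∞) (w : ℝ≥0∞) (hw : ∀ i, h i ≤ w)
    (φ : ι → κ) (J : Finset κ) (hJ : ∀ i, h i ≠ 0 → φ i ∈ J)
    (hφ : Set.InjOn φ (Function.support h)) : ∑' i, h i ≤ J.card * w := by
  rw [← tsum_subtype_support h]
  let ψ : Function.support h → J := fun i => ⟨φ i, hJ i i.2⟩
  have hψ : Function.Injective ψ := fun i j hij =>
    Subtype.ext (hφ i.2 j.2 (congrArg Subtype.val hij))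
  calc ∑' i : Function.support h, h i ≤ ∑' _ : Function.support h, w :=
        ENNReal.tsum_le_tsum fun i => hw i
    _ ≤ ∑' _ : J, w := ENNReal.tsum_comp_le_tsum_of_injective hψ fun _ => w
    _ = J.card * w := by simp

/-- The set of `x` with `|q x + p| ≤ δ`. -/
def strip (δ : ℝ) (q : ℕ) (p : ℤ) : Set ℝ := {x | |q * x + p| ≤ δ}

/-- The number of integers `p` with `|q x + p| ≤ δ`. -/
def stripCount (δ : ℝ) (q : ℕ) (x : ℝ) : ℝ≥0∞ := ∑' p : ℤ, (strip δ q p).indicator 1 x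

lemma mem_strip {δ : ℝ} {q : ℕ} {p : ℤ} {x : ℝ} :
    x ∈ strip δ q p ↔ -δ ≤ q * x + p ∧ q * x + p ≤ δ := by
  rw [strip, Set.mem_ofPred_eq, abs_le]

lemma measurableSet_strip (δ : ℝ) (q : ℕ) (p : ℤ) : MeasurableSet (strip δ q p) :=
  measurableSet_le (by fun_prop) measurable_const

lemma measurable_stripCount (δ : ℝ) (q : ℕ) : Measurable (stripCount δ q) :=
  Measurable.tsum fun p => measurable_one.indicator (measurableSet_strip δ q p)

lemma volume_strip_le (δ : ℝ) (q : ℕ) (hq : 0 < q) (p : ℤ) :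
    volume (strip δ q p) ≤ ENNReal.ofReal (2 * δ / q) := by
  have hq' : (0 : ℝ) < q := by exact_mod_cast hq
  have hsub : strip δ q p ⊆ Set.Icc ((-δ - p) / q) ((δ - p) / q) := by
    intro x hx
    obtain ⟨h1, h2⟩ := mem_strip.1 hx
    constructor
    · rw [div_le_iff₀ hq']; linarith
    · rw [le_div_iff₀ hq']; linarith
  refine (measure_mono hsub).trans (le_of_eq ?_)
  rw [Real.volume_Icc]
  congr 1
  ring

/-- The correlation of two strip counts, when the first frequency is the larger one. -/
lemma lintegral_stripCount_mul_le_of_le {c δ : ℝ} (hδ : 0 < δ) (hδc : δ ≤ c) {q r : ℕ}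
    (hr : 0 < r) (hrq : r ≤ q) :
    ∫⁻ x in Set.Ico (0 : ℝ) 1, stripCount δ q x * stripCount δ r x ≤
      ENNReal.ofReal ((2 * c + 3) * (8 * δ ^ 2 + 2 * δ * ((q.gcd r : ℝ) / q))) := by
  have hq : 0 < q := hr.trans_le hrq
  have hq' : (0 : ℝ) < q := by exact_mod_cast hq
  obtain ⟨a, b, hab, hqa, hrb⟩ := Nat.exists_coprime q r
  have hg : 0 < q.gcd r := Nat.gcd_pos_of_pos_left r hq
  set g := q.gcd r with hgdef
  have ha : 0 < a := Nat.pos_of_ne_zero (by rintro rfl; simp at hqa; lia)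
  have hba : b ≤ a := by
    rw [hqa, hrb] at hrq
    exact Nat.le_of_mul_le_mul_right hrq hg
  have hg1 : (1 : ℝ) ≤ g := by exact_mod_cast hg
  have ha1 : (1 : ℝ) ≤ a := by exact_mod_cast ha
  have hbaR : (b : ℝ) ≤ a := by exact_mod_cast hba
  have hb0 : (0 : ℝ) ≤ b := by positivity
  have hqR : (q : ℝ) = a * g := by exact_mod_cast hqa
  have hrR : (r : ℝ) = b * g := by exact_mod_cast hrb
  set S : ℤ × ℤ → Set ℝ := fun v => strip δ q v.1 ∩ strip δ r v.2 with hS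
  have hSm : ∀ v, MeasurableSet (S v) := fun v =>
    (measurableSet_strip δ q v.1).inter (measurableSet_strip δ r v.2)
  have hexp : ∀ x, stripCount δ q x * stripCount δ r x = ∑' v, (S v).indicator 1 x := by
    intro x
    rw [stripCount, stripCount, ENNReal.tsum_prod', ← ENNReal.tsum_mul_right]
    refine tsum_congr fun p => ?_
    rw [← ENNReal.tsum_mul_left]
    refine tsum_congr fun p' => ?_
    simp only [hS, Set.inter_indicator_one, Pi.mul_apply]
  simp_rw [hexp]
  rw [lintegral_tsum fun v => (measurable_one.indicator (hSm v)).aemeasurable]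
  simp_rw [lintegral_indicator_one (hSm _)]
  set J : Finset (ℤ × ℤ) := Finset.Icc ⌈-(2 * δ * a)⌉ ⌊2 * δ * a⌋ ×ˢ Finset.Icc ⌈-g - c - 1⌉ ⌊c⌋
  have hmem : ∀ v, volume.restrict (Set.Ico (0 : ℝ) 1) (S v) ≠ 0 →
      ((a : ℤ) * v.2 - b * v.1, v.1 / (a : ℤ)) ∈ J := by
    intro v hv
    rw [Measure.restrict_apply (hSm v)] at hv
    obtain ⟨x, ⟨hx1, hx2⟩, hx0, hx1'⟩ := nonempty_of_measure_ne_zero hv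
    obtain ⟨h1, h2⟩ := mem_strip.1 hx1
    obtain ⟨h3, h4⟩ := mem_strip.1 hx2
    have hkey : (a : ℝ) * v.2 - b * v.1 = a * (r * x + v.2) - b * (q * x + v.1) := by
      rw [hqR, hrR]; ring
    have e1 := Int.mul_ediv_add_emod v.1 a
    have e2 := Int.emod_nonneg v.1 (b := (a : ℤ)) (by lia)
    have e3 := Int.emod_lt_of_pos v.1 (b := (a : ℤ)) (by lia)
    set j := v.1 / (a : ℤ)
    have f1 : (a : ℝ) * j ≤ v.1 := by exact_mod_cast (by lia : (a : ℤ) * j ≤ v.1)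
    have f2 : (v.1 : ℝ) ≤ a * j + a := by exact_mod_cast (by lia : v.1 ≤ (a : ℤ) * j + a)
    simp only [J, Finset.mem_product, Finset.mem_Icc, Int.ceil_le, Int.le_floor]
    push_cast
    rw [hkey]
    refine ⟨⟨?_, ?_⟩, ?_, ?_⟩
    · nlinarith
    · nlinarith
    · have : (a : ℝ) * (-g - c - 1) ≤ a * j := by nlinarith
      exact le_of_mul_le_mul_left this (by linarith)
    · have h5 : (v.1 : ℝ) ≤ δ := by nlinarith
      have : (a : ℝ) * j ≤ a * c := by nlinarith
      exact le_of_mul_le_mul_left this (by linarith)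
  have hinj : Function.Injective fun v : ℤ × ℤ => ((a : ℤ) * v.2 - b * v.1, v.1 / (a : ℤ)) := by
    rintro ⟨p, p'⟩ ⟨s, s'⟩ h
    simp only [Prod.mk.injEq] at h
    obtain ⟨h1, h2⟩ := h
    have hdvd : (a : ℤ) ∣ b * (p - s) := ⟨p' - s', by linarith⟩
    have hcop : IsCoprime (a : ℤ) b := Nat.isCoprime_iff_coprime.2 hab
    have hmod : p % (a : ℤ) = s % (a : ℤ) :=
      (Int.modEq_iff_dvd.2 (hcop.dvd_of_dvd_mul_left hdvd)).symm
    have hps : p = s := by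
      rw [← Int.mul_ediv_add_emod p a, ← Int.mul_ediv_add_emod s a, h2, hmod]
    subst hps
    have : (a : ℤ) * p' = a * s' := by linarith
    rw [mul_left_cancel₀ (by lia) this]
  have hw : ∀ v, volume.restrict (Set.Ico (0 : ℝ) 1) (S v) ≤ ENNReal.ofReal (2 * δ / q) := fun v =>
    (Measure.restrict_apply_le _ _).trans
      ((measure_mono Set.inter_subset_left).trans (volume_strip_le δ q hq v.1))
  refine (tsum_le_card_mul _ _ hw _ J hmem hinj.injOn).trans ?_
  rw [← ENNReal.ofReal_natCast, ← ENNReal.ofReal_mul (Nat.cast_nonneg _)]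
  refine ENNReal.ofReal_le_ofReal ?_
  have c1 := card_Icc_ceil_floor_le (x := -(2 * δ * a)) (y := 2 * δ * a)
    (by nlinarith [mul_pos hδ (by linarith : (0 : ℝ) < a)])
  have c2 := card_Icc_ceil_floor_le (x := -g - c - 1) (y := c) (by linarith)
  have hcard : (J.card : ℝ) ≤ (4 * δ * a + 1) * ((2 * c + 3) * g) := by
    rw [Finset.card_product]
    push_cast
    refine mul_le_mul (by linarith) (c2.trans (by nlinarith)) (Nat.cast_nonneg _) ?_
    nlinarith [mul_pos hδ (by linarith : (0 : ℝ) < a)]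
  calc (J.card : ℝ) * (2 * δ / q)
      ≤ ((4 * δ * a + 1) * ((2 * c + 3) * g)) * (2 * δ / q) := by gcongr
    _ = _ := by rw [hqR]; field_simp; ring

lemma lintegral_stripCount_mul_le {c δ : ℝ} (hδ : 0 < δ) (hδc : δ ≤ c) {q r : ℕ}
    (hq : 0 < q) (hr : 0 < r) :
    ∫⁻ x in Set.Ico (0 : ℝ) 1, stripCount δ q x * stripCount δ r x ≤
      ENNReal.ofReal ((2 * c + 3) * (8 * δ ^ 2 + 2 * δ * ((q.gcd r : ℝ) / (max q r : ℕ)))) := by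
  rcases le_total r q with h | h
  · rw [max_eq_left h]
    exact lintegral_stripCount_mul_le_of_le hδ hδc hr h
  · rw [max_eq_right h, Nat.gcd_comm]
    simp_rw [mul_comm (stripCount δ q _)]
    exact lintegral_stripCount_mul_le_of_le hδ hδc hq h

/-- The Siegel sum is dominated by a sum of products of strip counts. -/
lemma siegelSum_le {c ξ β : ℝ} {f : ℝ × ℝ × ℝ → ℝ} (hξ : 0 < ξ)
    (hf : ∀ v, f v ∈ Set.Icc (0 : ℝ) 1)
    (hsupp : Function.support f ⊆ Set.Icc (-c) c ×ˢ Set.Icc (-c) c ×ˢ Set.Icc ξ β)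
    (n : ℕ × ℕ) (α : ℝ × ℝ) :
    siegelSum f n α ≤ ∑ q ∈ Finset.Ioc 0 ⌊β * Real.exp (n.1 + n.2)⌋₊,
      stripCount (c * Real.exp (-n.1)) q α.1 * stripCount (c * Real.exp (-n.2)) q α.2 := by
  set F : ℤ × ℤ × ℤ → ℝ≥0∞ := fun v =>
    ENNReal.ofReal (f (Real.exp (n.1 : ℝ) * ((v.2.2 : ℝ) * α.1 + (v.1 : ℝ)),
      Real.exp (n.2 : ℝ) * ((v.2.2 : ℝ) * α.2 + (v.2.1 : ℝ)),
      Real.exp (-(n.1 : ℝ) - (n.2 : ℝ)) * (v.2.2 : ℝ))) with hF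
  set K := ⌊β * Real.exp (n.1 + n.2)⌋₊ with hK
  have hbound : ∀ p₁ p₂ q : ℤ, F (p₁, p₂, q) ≠ 0 → ∃ m ∈ Finset.Ioc 0 K, (m : ℤ) = q ∧
      α.1 ∈ strip (c * Real.exp (-n.1)) m p₁ ∧ α.2 ∈ strip (c * Real.exp (-n.2)) m p₂ := by
    intro p₁ p₂ q h
    have hne : f (Real.exp (n.1 : ℝ) * ((q : ℝ) * α.1 + (p₁ : ℝ)),
      Real.exp (n.2 : ℝ) * ((q : ℝ) * α.2 + (p₂ : ℝ)),
      Real.exp (-(n.1 : ℝ) - (n.2 : ℝ)) * (q : ℝ)) ≠ 0 := by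
      intro h0
      simp [hF, h0] at h
    obtain ⟨h1, h2, h3⟩ := hsupp hne
    simp only [Set.mem_Icc] at h1 h2 h3
    have hscale : ∀ (k : ℕ) (y : ℝ), -c ≤ Real.exp k * y ∧ Real.exp k * y ≤ c →
        -(c * Real.exp (-k)) ≤ y ∧ y ≤ c * Real.exp (-k) := by
      rintro k y ⟨h, h'⟩
      have hpos := Real.exp_pos (-(k : ℝ))
      have hone : Real.exp (-(k : ℝ)) * Real.exp k = 1 := by rw [← Real.exp_add]; simp
      have hy : y = Real.exp (-(k : ℝ)) * (Real.exp k * y) := by rw [← mul_assoc, hone, one_mul]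
      rw [hy]
      constructor <;> nlinarith
    have hq0 : 0 < q := by
      by_contra hneg
      have : (q : ℝ) ≤ 0 := by exact_mod_cast not_lt.1 hneg
      nlinarith [Real.exp_pos (-(n.1 : ℝ) - (n.2 : ℝ))]
    obtain ⟨m, rfl⟩ := Int.eq_ofNat_of_zero_le hq0.le
    refine ⟨m, ?_, rfl, ?_, ?_⟩
    · rw [Finset.mem_Ioc]
      refine ⟨by lia, Nat.le_floor ?_⟩
      have hpos := Real.exp_pos ((n.1 : ℝ) + n.2)
      have hone : Real.exp ((n.1 : ℝ) + n.2) * Real.exp (-(n.1 : ℝ) - n.2) = 1 := by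
        rw [← Real.exp_add]; ring_nf; simp
      calc (m : ℝ) = Real.exp ((n.1 : ℝ) + n.2) * (Real.exp (-(n.1 : ℝ) - n.2) * m) := by
            rw [← mul_assoc, hone, one_mul]
        _ ≤ Real.exp ((n.1 : ℝ) + n.2) * β := by
            gcongr
            simpa using h3.2
        _ = _ := mul_comm _ _
    · exact mem_strip.2 (by simpa using hscale _ _ h1)
    · exact mem_strip.2 (by simpa using hscale _ _ h2)
  have hF1 : ∀ v, F v ≤ 1 := fun v => ENNReal.ofReal_le_one.2 (hf _).2
  have hzero : ∀ q : ℤ, q ∉ (Finset.Ioc 0 K).map Nat.castEmbedding →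
      ∑' p₁ : ℤ, ∑' p₂ : ℤ, F (p₁, p₂, q) = 0 := by
    intro q hq
    simp only [ENNReal.tsum_eq_zero]
    intro p₁ p₂
    by_contra h
    obtain ⟨m, hm, rfl, -⟩ := hbound p₁ p₂ q h
    exact hq (Finset.mem_map.2 ⟨m, hm, rfl⟩)
  calc siegelSum f n α ≤ ∑' v, F v :=
        ENNReal.tsum_comp_le_tsum_of_injective Subtype.val_injective F
    _ = ∑' q : ℤ, ∑' p₁ : ℤ, ∑' p₂ : ℤ, F (p₁, p₂, q) := by
        rw [ENNReal.tsum_prod', ENNReal.tsum_comm (α := ℤ) (β := ℤ)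
          (f := fun q p₁ => ∑' p₂ : ℤ, F (p₁, p₂, q))]
        refine tsum_congr fun p₁ => ?_
        rw [ENNReal.tsum_prod', ENNReal.tsum_comm]
    _ = ∑ q ∈ Finset.Ioc 0 K, ∑' p₁ : ℤ, ∑' p₂ : ℤ, F (p₁, p₂, (q : ℤ)) := by
        rw [tsum_eq_sum hzero, Finset.sum_map]
        rfl
    _ ≤ _ := by
        refine Finset.sum_le_sum fun q _ => ?_
        rw [stripCount, stripCount, ← ENNReal.tsum_mul_right]
        refine ENNReal.tsum_le_tsum fun p₁ => ?_
        rw [← ENNReal.tsum_mul_left]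
        refine ENNReal.tsum_le_tsum fun p₂ => ?_
        by_cases h : F (p₁, p₂, (q : ℤ)) = 0
        · rw [h]
          exact zero_le
        · obtain ⟨m, -, hmq, h1, h2⟩ := hbound p₁ p₂ q h
          obtain rfl : m = q := by exact_mod_cast hmq
          rw [Set.indicator_of_mem h1, Set.indicator_of_mem h2]
          simpa using hF1 _

lemma lintegral_box2_sq_sum_le {c δ₁ δ₂ : ℝ} (h₁ : 0 < δ₁) (h₁c : δ₁ ≤ c) (h₂ : 0 < δ₂)
    (h₂c : δ₂ ≤ c) (K : ℕ) :
    ∫⁻ α in box2, (∑ q ∈ Finset.Ioc 0 K, stripCount δ₁ q α.1 * stripCount δ₂ q α.2) ^ 2 ≤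
      ENNReal.ofReal (∑ q ∈ Finset.Ioc 0 K, ∑ r ∈ Finset.Ioc 0 K,
        ((2 * c + 3) * (8 * δ₁ ^ 2 + 2 * δ₁ * ((q.gcd r : ℝ) / (max q r : ℕ)))) *
        ((2 * c + 3) * (8 * δ₂ ^ 2 + 2 * δ₂ * ((q.gcd r : ℝ) / (max q r : ℕ))))) := by
  have hc : 0 < c := h₁.trans_le h₁c
  have hm := measurable_stripCount
  have hsq : ∀ α : ℝ × ℝ,
      (∑ q ∈ Finset.Ioc 0 K, stripCount δ₁ q α.1 * stripCount δ₂ q α.2) ^ 2 =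
      ∑ q ∈ Finset.Ioc 0 K, ∑ r ∈ Finset.Ioc 0 K,
        (stripCount δ₁ q α.1 * stripCount δ₁ r α.1) *
          (stripCount δ₂ q α.2 * stripCount δ₂ r α.2) := by
    intro α
    rw [sq, Finset.sum_mul_sum]
    refine Finset.sum_congr rfl fun q _ => Finset.sum_congr rfl fun r _ => ?_
    ring
  have hmeas : ∀ q r : ℕ, Measurable fun α : ℝ × ℝ =>
      (stripCount δ₁ q α.1 * stripCount δ₁ r α.1) *
        (stripCount δ₂ q α.2 * stripCount δ₂ r α.2) := fun q r =>
    (((hm δ₁ q).comp measurable_fst).mul ((hm δ₁ r).comp measurable_fst)).mul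
      (((hm δ₂ q).comp measurable_snd).mul ((hm δ₂ r).comp measurable_snd))
  simp_rw [hsq]
  rw [lintegral_finsetSum _ fun q _ => Finset.measurable_sum _ fun r _ => hmeas q r,
    ENNReal.ofReal_sum_of_nonneg fun q _ => Finset.sum_nonneg fun r _ => by positivity]
  refine Finset.sum_le_sum fun q hq => ?_
  rw [lintegral_finsetSum _ fun r _ => hmeas q r,
    ENNReal.ofReal_sum_of_nonneg fun r _ => by positivity]
  refine Finset.sum_le_sum fun r hr => ?_
  rw [Finset.mem_Ioc] at hq hr
  rw [box2, Measure.volume_eq_prod, ← Measure.prod_restrict,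
    lintegral_prod_mul (f := fun x => stripCount δ₁ q x * stripCount δ₁ r x)
      (g := fun x => stripCount δ₂ q x * stripCount δ₂ r x)
      ((hm δ₁ q).mul (hm δ₁ r)).aemeasurable ((hm δ₂ q).mul (hm δ₂ r)).aemeasurable,
    ENNReal.ofReal_mul (by positivity)]
  exact mul_le_mul' (lintegral_stripCount_mul_le h₁ h₁c hq.1 hr.1)
    (lintegral_stripCount_mul_le h₂ h₂c hq.1 hr.1)

lemma sum_correlation_bound_le {A δ₁ δ₂ : ℝ} (h₁ : 0 < δ₁) (h₂ : 0 < δ₂) (K : ℕ) :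
    ∑ q ∈ Finset.Ioc 0 K, ∑ r ∈ Finset.Ioc 0 K,
        (A * (8 * δ₁ ^ 2 + 2 * δ₁ * ((q.gcd r : ℝ) / (max q r : ℕ)))) *
        (A * (8 * δ₂ ^ 2 + 2 * δ₂ * ((q.gcd r : ℝ) / (max q r : ℕ)))) ≤
      A ^ 2 * (64 * (δ₁ * δ₂) ^ 2 * K ^ 2 +
        32 * (δ₁ * δ₂) * (δ₁ + δ₂) * (K * (1 + Real.log K)) + 16 * (δ₁ * δ₂) * K) := by
  have e : ∀ q r : ℕ, (A * (8 * δ₁ ^ 2 + 2 * δ₁ * ((q.gcd r : ℝ) / (max q r : ℕ)))) *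
        (A * (8 * δ₂ ^ 2 + 2 * δ₂ * ((q.gcd r : ℝ) / (max q r : ℕ)))) =
      A ^ 2 * (64 * (δ₁ * δ₂) ^ 2 +
        16 * (δ₁ * δ₂) * (δ₁ + δ₂) * ((q.gcd r : ℝ) / (max q r : ℕ)) +
        4 * (δ₁ * δ₂) * ((q.gcd r : ℝ) / (max q r : ℕ)) ^ 2) := fun q r => by ring
  simp_rw [e, ← Finset.mul_sum, Finset.sum_add_distrib, ← Finset.mul_sum]
  refine mul_le_mul_of_nonneg_left ?_ (sq_nonneg A)
  have s1 := mul_le_mul_of_nonneg_left (sum_gcd_div_max_le K)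
    (by positivity : 0 ≤ 16 * (δ₁ * δ₂) * (δ₁ + δ₂))
  have s2 := mul_le_mul_of_nonneg_left (sum_sq_gcd_div_max_le K)
    (by positivity : 0 ≤ 4 * (δ₁ * δ₂))
  have s0 : ∑ q ∈ Finset.Ioc 0 K, ∑ r ∈ Finset.Ioc 0 K, (δ₁ * δ₂) ^ 2 =
      (δ₁ * δ₂) ^ 2 * K ^ 2 := by
    simp; ring
  linarith

lemma exp_neg_add_exp_neg_mul_le (a b : ℕ) :
    (Real.exp (-a) + Real.exp (-b)) * (1 + (a + b)) ≤
      6 * max 1 (((max a b : ℕ) : ℝ) * Real.exp (-((min a b : ℕ) : ℝ))) := by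
  set M : ℝ := ((max a b : ℕ) : ℝ)
  set E : ℝ := Real.exp (-((min a b : ℕ) : ℝ))
  have ha : Real.exp (-(a : ℝ)) ≤ E :=
    Real.exp_le_exp.2 (neg_le_neg (Nat.cast_le.2 (min_le_left a b)))
  have hb : Real.exp (-(b : ℝ)) ≤ E :=
    Real.exp_le_exp.2 (neg_le_neg (Nat.cast_le.2 (min_le_right a b)))
  have hE : E ≤ 1 := Real.exp_le_one_iff.2 (neg_nonpos.2 (Nat.cast_nonneg _))
  have haM : (a : ℝ) ≤ M := Nat.cast_le.2 (le_max_left a b)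
  have hbM : (b : ℝ) ≤ M := Nat.cast_le.2 (le_max_right a b)
  have hE0 : 0 < E := Real.exp_pos _
  have h1 := le_max_left 1 (M * E)
  have h2 := le_max_right 1 (M * E)
  calc _ ≤ (E + E) * (1 + (M + M)) := by gcongr
    _ ≤ _ := by nlinarith

theorem stmt12 (c : ℝ) (hc : 0 < c) :
    ∃ C > 0, ∀ (ξ β : ℝ) (f : ℝ × ℝ × ℝ → ℝ), 0 < ξ → ξ < β → β ≤ 1 →
      Measurable f → (∀ v, f v ∈ Set.Icc (0:ℝ) 1) →
      Function.support f ⊆ Set.Icc (-c) c ×ˢ Set.Icc (-c) c ×ˢ Set.Icc ξ β →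
      ∀ n : ℕ × ℕ,
        (∫⁻ α in box2, (siegelSum f n α) ^ 2) ≤
          ENNReal.ofReal (C * β * max 1 (Real.log (β / ξ)) ^ 2 *
            max 1 (((max n.1 n.2 : ℕ) : ℝ) * Real.exp (-((min n.1 n.2 : ℕ) : ℝ)))) := by
  refine ⟨(2 * c + 3) ^ 2 * (64 * c ^ 4 + 192 * c ^ 3 + 16 * c ^ 2), by positivity, ?_⟩
  intro ξ β f hξ hξβ hβ _ hf hsupp n
  have hβ0 : 0 < β := hξ.trans hξβ
  have hδ : ∀ k : ℕ, 0 < c * Real.exp (-(k : ℝ)) ∧ c * Real.exp (-(k : ℝ)) ≤ c := fun k =>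
    ⟨by positivity, mul_le_of_le_one_right hc.le
      (Real.exp_le_one_iff.2 (neg_nonpos.2 (Nat.cast_nonneg k)))⟩
  set N : ℝ := Real.exp (n.1 + n.2) with hN
  set K := ⌊β * N⌋₊ with hK
  calc ∫⁻ α in box2, (siegelSum f n α) ^ 2
      ≤ ∫⁻ α in box2, (∑ q ∈ Finset.Ioc 0 K, stripCount (c * Real.exp (-n.1)) q α.1 *
          stripCount (c * Real.exp (-n.2)) q α.2) ^ 2 :=
        lintegral_mono fun α => pow_le_pow_left' (siegelSum_le hξ hf hsupp n α) 2
    _ ≤ _ := lintegral_box2_sq_sum_le (hδ n.1).1 (hδ n.1).2 (hδ n.2).1 (hδ n.2).2 K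
    _ ≤ _ := ENNReal.ofReal_le_ofReal ?_
  refine (sum_correlation_bound_le (hδ n.1).1 (hδ n.2).1 K).trans ?_
  have hN1 : 1 ≤ N := Real.one_le_exp (by positivity)
  have hprod : c * Real.exp (-n.1) * (c * Real.exp (-n.2)) = c ^ 2 / N := by
    rw [hN, Real.exp_add, Real.exp_neg, Real.exp_neg]
    field_simp
  have hKβ : (K : ℝ) ≤ β * N := Nat.floor_le (by positivity)
  have hlog : Real.log K ≤ n.1 + n.2 := by
    rcases Nat.eq_zero_or_pos K with h0 | h0
    · rw [h0, Nat.cast_zero, Real.log_zero]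
      positivity
    · rw [Real.log_le_iff_le_exp (by exact_mod_cast h0)]
      exact hKβ.trans (mul_le_of_le_one_left (by positivity) hβ)
  have hexp := exp_neg_add_exp_neg_mul_le n.1 n.2
  set W := max 1 (((max n.1 n.2 : ℕ) : ℝ) * Real.exp (-((min n.1 n.2 : ℕ) : ℝ)))
  have hW : 1 ≤ W := le_max_left _ _
  have hL : 1 ≤ max 1 (Real.log (β / ξ)) ^ 2 := one_le_pow₀ (le_max_left _ _)
  have t1 : 64 * (c ^ 2 / N) ^ 2 * (K : ℝ) ^ 2 ≤ 64 * c ^ 4 * (β * W) := by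
    calc 64 * (c ^ 2 / N) ^ 2 * (K : ℝ) ^ 2 ≤ 64 * (c ^ 2 / N) ^ 2 * (β * N) ^ 2 := by gcongr
      _ = 64 * c ^ 4 * (β * β) := by field_simp
      _ ≤ _ := by gcongr; exact hβ.trans hW
  have t2 : 32 * (c ^ 2 / N) * (c * Real.exp (-n.1) + c * Real.exp (-n.2)) *
      (K * (1 + Real.log K)) ≤ 192 * c ^ 3 * (β * W) := by
    calc _ ≤ 32 * (c ^ 2 / N) * (c * Real.exp (-n.1) + c * Real.exp (-n.2)) *
          ((β * N) * (1 + (n.1 + n.2))) := by gcongr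
      _ = 32 * c ^ 3 * β * ((Real.exp (-n.1) + Real.exp (-n.2)) * (1 + (n.1 + n.2))) := by
          field_simp
      _ ≤ 32 * c ^ 3 * β * (6 * W) := by gcongr
      _ = _ := by ring
  have t3 : 16 * (c ^ 2 / N) * (K : ℝ) ≤ 16 * c ^ 2 * (β * W) := by
    calc 16 * (c ^ 2 / N) * (K : ℝ) ≤ 16 * (c ^ 2 / N) * (β * N) := by gcongr
      _ = 16 * c ^ 2 * (β * 1) := by field_simp
      _ ≤ _ := by gcongr
  rw [hprod]
  calc _ ≤ (2 * c + 3) ^ 2 * ((64 * c ^ 4 + 192 * c ^ 3 + 16 * c ^ 2) * (β * W)) := by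
        gcongr
        linarith
    _ = (2 * c + 3) ^ 2 * (64 * c ^ 4 + 192 * c ^ 3 + 16 * c ^ 2) * β * 1 * W := by ring
    _ ≤ _ := by gcongr

end
end

section
/- There is an absolute constant C > 0 with the following property. Let s ∈ ℝ, β, η > 0, and let m be a nonnegative integer such that η < β^{-1/2}·e^{m/2+s}. For x = (x₁,x₂,x₃) ∈ ℝ³ let g_x : ℝ³ → ℝ³ be the linear map g_x(v₁,v₂,v₃) := (β^{-1/2}e^{-m/2}e^{s}(v₁+x₁v₃), e^{m}(x₂v₁+v₂+x₃v₃), β^{-1/2}e^{-m/2}e^{-s}v₃). Let B* be the set of x ∈ [−1/2,1/2]³ for which there exist linearly independent v, v' ∈ ℤ³ with ‖g_x(v) ∧ g_x(v')‖_∞ ≤ η. Then Vol(B*) ≤ C·(η³·β² + η⁴·β^{5/2}·e^{−m/2+s} + η³·β^{3/2}·e^{−3m/2+|s|}). -/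
open MeasureTheory
open scoped ENNReal

noncomputable section

/-- The cube `[-1/2,1/2]³`. -/
def cube3 : Set (ℝ × ℝ × ℝ) :=
  Set.Icc (-(1:ℝ)/2) (1/2) ×ˢ Set.Icc (-(1:ℝ)/2) (1/2) ×ˢ Set.Icc (-(1:ℝ)/2) (1/2)

/-- The linear map `g_x(v) = (β^{-1/2}e^{-m/2}e^{s}(v₁+x₁v₃), e^{m}(x₂v₁+v₂+x₃v₃),
β^{-1/2}e^{-m/2}e^{-s}v₃)`. -/
def gmap (β : ℝ) (m : ℕ) (s : ℝ) (x : ℝ × ℝ × ℝ) (v : ℝ × ℝ × ℝ) : ℝ × ℝ × ℝ :=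
  ((Real.sqrt β)⁻¹ * Real.exp (-(m : ℝ) / 2) * Real.exp s * (v.1 + x.1 * v.2.2),
   Real.exp (m : ℝ) * (x.2.1 * v.1 + v.2.1 + x.2.2 * v.2.2),
   (Real.sqrt β)⁻¹ * Real.exp (-(m : ℝ) / 2) * Real.exp (-s) * v.2.2)

/-- The translates by integers of the condition `|p t + c| ≤ ε` have total measure `O(ε)` on the
unit interval, uniformly in the nonzero integer `p` and the real number `c`. -/
theorem tsum_volume_abs_mul_add_int_le {p : ℤ} (hp : p ≠ 0) (c : ℝ) {ε : ℝ} (hε : 0 ≤ ε) :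
    ∑' r : ℤ, volume {t : ℝ | t ∈ Set.Icc (-(1:ℝ)/2) (1/2) ∧ |p * t + c + r| ≤ ε} ≤
      ENNReal.ofReal (8 * ε) := by
  set P : ℝ := |(p : ℝ)| with hP
  have hP1 : 1 ≤ P := by
    rw [hP]; exact_mod_cast Int.one_le_abs hp
  have hP0 : 0 < P := by linarith
  have hp' : (p : ℝ) ≠ 0 := by exact_mod_cast hp
  set F : Finset ℤ := Finset.Icc ⌈-c - P / 2 - ε⌉ ⌊-c + P / 2 + ε⌋ with hF
  have hcard : (F.card : ℝ) ≤ P + 2 * ε + 1 := by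
    rw [hF, Int.card_Icc]
    have h1 := Int.floor_le (-c + P / 2 + ε)
    have h2 := Int.le_ceil (-c - P / 2 - ε)
    have h3 : (((⌊-c + P / 2 + ε⌋ + 1 - ⌈-c - P / 2 - ε⌉).toNat : ℤ) : ℝ) ≤ P + 2 * ε + 1 := by
      rw [Int.toNat_eq_max]
      push_cast
      apply max_le <;> linarith
    exact_mod_cast h3
  have hzero : ∀ r ∉ F,
      volume {t : ℝ | t ∈ Set.Icc (-(1:ℝ)/2) (1/2) ∧ |p * t + c + r| ≤ ε} = 0 := by
    intro r hr
    convert measure_empty (μ := (volume : Measure ℝ))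
    refine Set.eq_empty_of_forall_notMem ?_
    rintro t ⟨ht, h⟩
    apply hr
    have htabs : |(p : ℝ) * t| ≤ P / 2 := by
      rw [abs_mul]
      have : |t| ≤ 1 / 2 := abs_le.2 ⟨by linarith [ht.1], ht.2⟩
      nlinarith
    rw [abs_le] at h htabs
    rw [hF, Finset.mem_Icc, Int.ceil_le, Int.le_floor]
    constructor <;> linarith [h.1, h.2, htabs.1, htabs.2]
  have hone : ∀ r : ℤ,
      volume {t : ℝ | t ∈ Set.Icc (-(1:ℝ)/2) (1/2) ∧ |p * t + c + r| ≤ ε} ≤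
        ENNReal.ofReal (min 1 (2 * (ε / P))) := by
    intro r
    rw [ENNReal.ofReal_min]
    refine le_min ?_ ?_
    · refine (measure_mono fun t ht => ht.1).trans_eq ?_
      rw [Real.volume_Icc]; norm_num
    · rw [← Real.volume_closedBall (-(c + r) / p)]
      refine measure_mono fun t ht => ?_
      rw [Metric.mem_closedBall, Real.dist_eq, le_div_iff₀ hP0, hP, ← abs_mul]
      have : (t - -(c + r) / p) * p = p * t + c + r := by
        field_simp
        ring
      rw [this]
      exact ht.2
  rw [tsum_eq_sum hzero]
  calc _ ≤ ∑ _r ∈ F, ENNReal.ofReal (min 1 (2 * (ε / P))) := Finset.sum_le_sum fun r _ => hone r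
    _ = ENNReal.ofReal (F.card * min 1 (2 * (ε / P))) := by
      rw [Finset.sum_const, nsmul_eq_mul, ENNReal.ofReal_mul (by positivity),
        ENNReal.ofReal_natCast]
    _ ≤ ENNReal.ofReal (8 * ε) := by
      apply ENNReal.ofReal_le_ofReal
      rcases le_total ε P with h | h
      · calc _ ≤ (4 * P) * (2 * (ε / P)) := by
              gcongr
              · linarith
              · exact min_le_right _ _
          _ = 8 * ε := by field_simp; ring
      · calc _ ≤ (4 * ε) * 1 := by
              gcongr
              · linarith
              · exact min_le_left _ _
          _ ≤ 8 * ε := by linarith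

/-- A measurable set over `A × B` whose fibres have measure at most `K` has measure at most
`|A| |B| K`. -/
theorem volume_le_of_fibre_le {S : Set (ℝ × ℝ × ℝ)} (hS : MeasurableSet S) {A B : Set ℝ}
    (hA : MeasurableSet A) (hB : MeasurableSet B) (hSA : ∀ x ∈ S, x.1 ∈ A)
    (hSB : ∀ x ∈ S, x.2.1 ∈ B) {K : ℝ≥0∞} (hK : ∀ a b, volume {t : ℝ | (a, b, t) ∈ S} ≤ K) :
    volume S ≤ volume A * (volume B * K) := by
  have hinner : ∀ a, volume (Prod.mk a ⁻¹' S) ≤ A.indicator (fun _ => volume B * K) a := by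
    intro a
    by_cases ha : a ∈ A
    · rw [Set.indicator_of_mem ha, Measure.volume_eq_prod,
        Measure.prod_apply (measurable_prodMk_left hS), mul_comm, ← lintegral_indicator_const hB]
      refine lintegral_mono fun b => ?_
      by_cases hb : b ∈ B
      · rw [Set.indicator_of_mem hb]
        exact hK a b
      · rw [Set.indicator_of_notMem hb, nonpos_iff_eq_zero]
        convert measure_empty (μ := (volume : Measure ℝ))
        exact Set.eq_empty_of_forall_notMem fun t ht => hb (hSB _ ht)
    · rw [Set.indicator_of_notMem ha, nonpos_iff_eq_zero]
      convert measure_empty (μ := (volume : Measure (ℝ × ℝ)))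
      exact Set.eq_empty_of_forall_notMem fun t ht => ha (hSA _ ht)
  rw [Measure.volume_eq_prod, Measure.prod_apply hS, mul_comm, ← lintegral_indicator_const hA]
  exact lintegral_mono hinner

/-- The contribution of a fixed nonzero Plücker coordinate `p = w₁₃`. -/
theorem volume_plucker_ne_zero_le {p : ℤ} (hp : p ≠ 0) {δ ε : ℝ} (hδ : 0 ≤ δ) (hε : 0 ≤ ε) :
    volume {x : ℝ × ℝ × ℝ | x ∈ cube3 ∧ ∃ q r : ℤ, |p * x.2.1 + q| ≤ ε ∧
        |r + (x.2.2 - x.1 * x.2.1) * p - x.1 * q| ≤ δ} ≤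
      ENNReal.ofReal (64 * ε * δ) := by
  let T : ℤ → Set ℝ := fun q => {t | t ∈ Set.Icc (-(1:ℝ)/2) (1/2) ∧ |p * t + 0 + q| ≤ ε}
  let S : ℤ → Set (ℝ × ℝ × ℝ) := fun q => ⋃ r : ℤ, {x | x ∈ cube3 ∧ |p * x.2.1 + 0 + q| ≤ ε ∧
    |r + (x.2.2 - x.1 * x.2.1) * p - x.1 * q| ≤ δ}
  have hcube : MeasurableSet cube3 :=
    measurableSet_Icc.prod (measurableSet_Icc.prod measurableSet_Icc)
  have hT : ∀ q, MeasurableSet (T q) := fun q => measurableSet_Icc.inter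
    (measurableSet_le (f := fun t : ℝ => |p * t + 0 + q|) (g := fun _ => ε)
      (by fun_prop) (by fun_prop))
  have hS : ∀ q, MeasurableSet (S q) := fun q => MeasurableSet.iUnion fun r =>
    hcube.inter ((measurableSet_le (f := fun x : ℝ × ℝ × ℝ => |p * x.2.1 + 0 + q|)
      (g := fun _ => ε) (by fun_prop) (by fun_prop)).inter
      (measurableSet_le
        (f := fun x : ℝ × ℝ × ℝ => |r + (x.2.2 - x.1 * x.2.1) * p - x.1 * q|)
        (g := fun _ => δ) (by fun_prop) (by fun_prop)))
  have hvol : ∀ q, volume (S q) ≤ volume (T q) * ENNReal.ofReal (8 * δ) := by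
    intro q
    have h := volume_le_of_fibre_le (hS q) (A := Set.Icc (-(1:ℝ)/2) (1/2)) (B := T q)
      (K := ENNReal.ofReal (8 * δ)) measurableSet_Icc (hT q) ?_ ?_ ?_
    · refine h.trans_eq ?_
      rw [Real.volume_Icc]; norm_num
    · intro x hx
      obtain ⟨r, hx⟩ := Set.mem_iUnion.1 hx
      exact hx.1.1
    · intro x hx
      obtain ⟨r, hx⟩ := Set.mem_iUnion.1 hx
      exact ⟨hx.1.2.1, hx.2.1⟩
    · intro a b
      refine le_trans ?_ (tsum_volume_abs_mul_add_int_le hp (-a * b * p - a * q) hδ)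
      refine le_trans (measure_mono ?_) (measure_iUnion_le _)
      intro t ht
      obtain ⟨r, ht⟩ := Set.mem_iUnion.1 ht
      refine Set.mem_iUnion.2 ⟨r, ht.1.2.2, ?_⟩
      convert ht.2.2 using 2
      ring
  calc _ ≤ volume (⋃ q, S q) := by
        refine measure_mono ?_
        rintro x ⟨hx, q, r, h1, h2⟩
        exact Set.mem_iUnion.2 ⟨q, Set.mem_iUnion.2 ⟨r, hx, by rwa [add_zero], h2⟩⟩
    _ ≤ ∑' q, volume (S q) := measure_iUnion_le _
    _ ≤ ∑' q, volume (T q) * ENNReal.ofReal (8 * δ) := ENNReal.tsum_le_tsum hvol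
    _ ≤ ENNReal.ofReal (8 * ε) * ENNReal.ofReal (8 * δ) := by
        rw [ENNReal.tsum_mul_right]
        gcongr
        exact tsum_volume_abs_mul_add_int_le hp 0 hε
    _ = ENNReal.ofReal (64 * ε * δ) := by
        rw [← ENNReal.ofReal_mul (by positivity)]
        ring_nf

/-- The contribution of `w₁₃ = 0` and a fixed nonzero Plücker coordinate `q = w₂₃`. -/
theorem volume_plucker_zero_le {q : ℤ} (hq : q ≠ 0) {δ : ℝ} (hδ : 0 ≤ δ) :
    volume {x : ℝ × ℝ × ℝ | x ∈ cube3 ∧ ∃ r : ℤ, |r - x.1 * q| ≤ δ} ≤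
      ENNReal.ofReal (8 * δ) := by
  let H : ℤ → Set ℝ := fun r => {t | t ∈ Set.Icc (-(1:ℝ)/2) (1/2) ∧ |(-q : ℤ) * t + 0 + r| ≤ δ}
  calc _ ≤ volume ((⋃ r, H r) ×ˢ Set.Icc (-(1:ℝ)/2) (1/2) ×ˢ Set.Icc (-(1:ℝ)/2) (1/2)) := by
        refine measure_mono ?_
        rintro x ⟨hx, r, h⟩
        refine ⟨Set.mem_iUnion.2 ⟨r, hx.1, ?_⟩, hx.2⟩
        convert h using 2
        push_cast
        ring
    _ = volume (⋃ r, H r) := by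
        rw [Measure.volume_eq_prod, Measure.prod_prod, Measure.volume_eq_prod, Measure.prod_prod,
          Real.volume_Icc]
        norm_num
    _ ≤ _ := (measure_iUnion_le _).trans
        (tsum_volume_abs_mul_add_int_le (neg_ne_zero.2 hq) 0 hδ)

/-- A union bound over the nonzero integers of absolute value at most `N`. -/
theorem measure_biUnion_int_le {α : Type*} [MeasurableSpace α] (μ : Measure α) (E : ℤ → Set α)
    {N : ℝ} (hN : 0 ≤ N) {K : ℝ≥0∞} (hE : ∀ p ≠ 0, μ (E p) ≤ K) :
    μ {x | ∃ p : ℤ, p ≠ 0 ∧ |(p : ℝ)| ≤ N ∧ x ∈ E p} ≤ ENNReal.ofReal (2 * N) * K := by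
  set F : Finset ℤ := (Finset.Icc (-⌊N⌋) ⌊N⌋).erase 0 with hF
  have hfloor : 0 ≤ ⌊N⌋ := Int.floor_nonneg.2 hN
  have hcard : (F.card : ℝ) ≤ 2 * N := by
    rw [hF, Finset.card_erase_of_mem (by simpa using hfloor), Int.card_Icc]
    have h : (((⌊N⌋ + 1 - -⌊N⌋).toNat - 1 : ℕ) : ℤ) = 2 * ⌊N⌋ := by omega
    have h' : (((⌊N⌋ + 1 - -⌊N⌋).toNat - 1 : ℕ) : ℝ) = 2 * ⌊N⌋ := by exact_mod_cast h
    rw [h']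
    linarith [Int.floor_le N]
  calc _ ≤ μ (⋃ p ∈ F, E p) := by
        refine measure_mono ?_
        rintro x ⟨p, hp, hpN, hx⟩
        refine Set.mem_biUnion (Finset.mem_erase.2 ⟨hp, Finset.mem_Icc.2 ?_⟩) hx
        rw [abs_le] at hpN
        constructor
        · rw [neg_le, Int.le_floor]
          push_cast
          linarith [hpN.1]
        · exact Int.le_floor.2 hpN.2
    _ ≤ ∑ p ∈ F, μ (E p) := measure_biUnion_finset_le _ _
    _ ≤ ∑ _p ∈ F, K := Finset.sum_le_sum fun p hp => hE p (Finset.ne_of_mem_erase hp)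
    _ = ENNReal.ofReal F.card * K := by
        rw [Finset.sum_const, nsmul_eq_mul, ENNReal.ofReal_natCast]
    _ ≤ _ := by gcongr

/-- Vectors of `ℝ³` whose Plücker coordinates all vanish are linearly dependent. -/
theorem not_linearIndependent_of_plucker_eq_zero {v w : ℝ × ℝ × ℝ}
    (h12 : v.1 * w.2.1 - v.2.1 * w.1 = 0) (h13 : v.1 * w.2.2 - v.2.2 * w.1 = 0)
    (h23 : v.2.1 * w.2.2 - v.2.2 * w.2.1 = 0) : ¬ LinearIndependent ℝ ![v, w] := by
  intro h
  rw [LinearIndependent.pair_iff] at h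
  obtain ⟨v1, v2, v3⟩ := v
  obtain ⟨w1, w2, w3⟩ := w
  simp only at h12 h13 h23
  have hv3 := (h w3 (-v3) (by simp only [Prod.smul_mk, Prod.mk_add_mk, smul_eq_mul, Prod.mk_eq_zero]
                              refine ⟨?_, ?_, ?_⟩ <;> linarith)).2
  have hv2 := (h w2 (-v2) (by simp only [Prod.smul_mk, Prod.mk_add_mk, smul_eq_mul, Prod.mk_eq_zero]
                              refine ⟨?_, ?_, ?_⟩ <;> linarith)).2
  have hv1 := (h w1 (-v1) (by simp only [Prod.smul_mk, Prod.mk_add_mk, smul_eq_mul, Prod.mk_eq_zero]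
                              refine ⟨?_, ?_, ?_⟩ <;> linarith)).2
  rw [neg_eq_zero] at hv1 hv2 hv3
  exact one_ne_zero (h 1 0 (by simp [hv1, hv2, hv3])).1

/-- The wedge bound for `g_x v`, `g_x w` in terms of the Plücker coordinates of `v`, `w`. -/
theorem plucker_bounds_of_wedgeNorm_le {s β η : ℝ} {m : ℕ} (hβ : 0 < β) {x v w : ℝ × ℝ × ℝ}
    (h : wedgeNorm (gmap β m s x v) (gmap β m s x w) ≤ η) :
    |v.1 * w.2.2 - v.2.2 * w.1| ≤ η * √β ^ 2 * Real.exp (m / 2) ^ 2 ∧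
    |(v.1 * w.2.2 - v.2.2 * w.1) * x.2.1 + (v.2.1 * w.2.2 - v.2.2 * w.2.1)| ≤
      η * √β * Real.exp s / Real.exp (m / 2) ∧
    |(v.1 * w.2.1 - v.2.1 * w.1) + (x.2.2 - x.1 * x.2.1) * (v.1 * w.2.2 - v.2.2 * w.1) -
        x.1 * (v.2.1 * w.2.2 - v.2.2 * w.2.1)| ≤ η * √β / (Real.exp (m / 2) * Real.exp s) := by
  have hb : 0 < √β := Real.sqrt_pos.2 hβ
  have hE : 0 < Real.exp ((m : ℝ) / 2) := Real.exp_pos _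
  have hS : 0 < Real.exp s := Real.exp_pos _
  have hM : Real.exp (m : ℝ) = Real.exp ((m : ℝ) / 2) ^ 2 := by
    rw [← Real.exp_nat_mul]; congr 1; push_cast; ring
  simp only [wedgeNorm, gmap, max_le_iff, hM, neg_div, Real.exp_neg] at h
  generalize √β = b at *
  generalize Real.exp ((m : ℝ) / 2) = E at *
  generalize Real.exp s = S at *
  obtain ⟨h12, h13, h23⟩ := h
  refine ⟨?_, ?_, ?_⟩
  · calc _ = |(b ^ 2 * E ^ 2) * (b⁻¹ * E⁻¹ * S * (v.1 + x.1 * v.2.2) * (b⁻¹ * E⁻¹ * S⁻¹ * w.2.2) -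
          b⁻¹ * E⁻¹ * S⁻¹ * v.2.2 * (b⁻¹ * E⁻¹ * S * (w.1 + x.1 * w.2.2)))| := by
            congr 1; field_simp; ring
      _ ≤ (b ^ 2 * E ^ 2) * η := by
            rw [abs_mul, abs_of_pos (by positivity : 0 < b ^ 2 * E ^ 2)]; gcongr
      _ = _ := by ring
  · calc _ = |(b * S / E) * (E ^ 2 * (x.2.1 * v.1 + v.2.1 + x.2.2 * v.2.2) *
          (b⁻¹ * E⁻¹ * S⁻¹ * w.2.2) - b⁻¹ * E⁻¹ * S⁻¹ * v.2.2 *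
          (E ^ 2 * (x.2.1 * w.1 + w.2.1 + x.2.2 * w.2.2)))| := by
            congr 1; field_simp; ring
      _ ≤ (b * S / E) * η := by
            rw [abs_mul, abs_of_pos (by positivity : 0 < b * S / E)]; gcongr
      _ = _ := by ring
  · calc _ = |(b / (E * S)) * (b⁻¹ * E⁻¹ * S * (v.1 + x.1 * v.2.2) *
          (E ^ 2 * (x.2.1 * w.1 + w.2.1 + x.2.2 * w.2.2)) -
          E ^ 2 * (x.2.1 * v.1 + v.2.1 + x.2.2 * v.2.2) *
          (b⁻¹ * E⁻¹ * S * (w.1 + x.1 * w.2.2)))| := by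
            congr 1; field_simp; ring
      _ ≤ (b / (E * S)) * η := by
            rw [abs_mul, abs_of_pos (by positivity : 0 < b / (E * S))]; gcongr
      _ = _ := by ring

theorem stmt14 :
    ∃ C > 0, ∀ (s β η : ℝ) (m : ℕ), 0 < β → 0 < η →
      η < (Real.sqrt β)⁻¹ * Real.exp ((m : ℝ) / 2 + s) →
      volume {x : ℝ × ℝ × ℝ | x ∈ cube3 ∧ ∃ v v' : ℤ × ℤ × ℤ,
          LinearIndependent ℝ
            ![(((v.1 : ℝ), (v.2.1 : ℝ), (v.2.2 : ℝ)) : ℝ × ℝ × ℝ),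
              (((v'.1 : ℝ), (v'.2.1 : ℝ), (v'.2.2 : ℝ)) : ℝ × ℝ × ℝ)] ∧
          wedgeNorm (gmap β m s x ((v.1 : ℝ), (v.2.1 : ℝ), (v.2.2 : ℝ)))
            (gmap β m s x ((v'.1 : ℝ), (v'.2.1 : ℝ), (v'.2.2 : ℝ))) ≤ η} ≤
        ENNReal.ofReal (C * (η ^ 3 * β ^ 2 +
          η ^ 4 * β ^ ((5:ℝ)/2) * Real.exp (-(m : ℝ) / 2 + s) +
          η ^ 3 * β ^ ((3:ℝ)/2) * Real.exp (-3 * (m : ℝ) / 2 + |s|))) := by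
  refine ⟨128, by norm_num, ?_⟩
  intro s β η m hβ hη hηlt
  have hb : 0 < √β := Real.sqrt_pos.2 hβ
  have hE : 0 < Real.exp ((m : ℝ) / 2) := Real.exp_pos _
  have hS : 0 < Real.exp s := Real.exp_pos _
  set N : ℝ := η * √β ^ 2 * Real.exp (m / 2) ^ 2 with hN
  set ε : ℝ := η * √β * Real.exp s / Real.exp (m / 2) with hε
  set δ : ℝ := η * √β / (Real.exp (m / 2) * Real.exp s) with hδ
  have hN0 : 0 ≤ N := by positivity
  have hε0 : 0 ≤ ε := by positivity
  have hδ0 : 0 ≤ δ := by positivity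
  have hδ1 : δ < 1 := by
    rw [hδ, div_lt_one (by positivity), ← Real.exp_add]
    calc η * √β < (√β)⁻¹ * Real.exp ((m : ℝ) / 2 + s) * √β := by gcongr
      _ = _ := by field_simp
  let E₁ : ℤ → Set (ℝ × ℝ × ℝ) := fun p => {x | x ∈ cube3 ∧ ∃ q r : ℤ, |p * x.2.1 + q| ≤ ε ∧
        |r + (x.2.2 - x.1 * x.2.1) * p - x.1 * q| ≤ δ}
  let E₂ : ℤ → Set (ℝ × ℝ × ℝ) := fun q => {x | x ∈ cube3 ∧ ∃ r : ℤ, |r - x.1 * q| ≤ δ}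
  have hE₁ := measure_biUnion_int_le volume E₁ hN0 fun p hp => volume_plucker_ne_zero_le hp hδ0 hε0
  have hE₂ := measure_biUnion_int_le volume E₂ hε0 fun q hq => volume_plucker_zero_le hq hδ0
  have hE₂' : volume {x | ∃ q : ℤ, q ≠ 0 ∧ |(q : ℝ)| ≤ ε ∧ x ∈ E₂ q} ≤
      ENNReal.ofReal (16 * (δ * ε ^ 2)) := by
    rcases lt_or_ge ε 1 with h | h
    · refine le_of_eq_of_le (b := 0) ?_ zero_le
      convert measure_empty (μ := (volume : Measure (ℝ × ℝ × ℝ)))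
      refine Set.eq_empty_of_forall_notMem ?_
      rintro x ⟨q, hq, hqε, -⟩
      have : (1 : ℝ) ≤ |(q : ℝ)| := by exact_mod_cast Int.one_le_abs hq
      linarith
    · refine hE₂.trans ?_
      rw [← ENNReal.ofReal_mul (by positivity)]
      apply ENNReal.ofReal_le_ofReal
      nlinarith [mul_nonneg (mul_nonneg hδ0 hε0) (sub_nonneg.2 h)]
  calc _ ≤ volume ({x | ∃ p : ℤ, p ≠ 0 ∧ |(p : ℝ)| ≤ N ∧ x ∈ E₁ p} ∪
          {x | ∃ q : ℤ, q ≠ 0 ∧ |(q : ℝ)| ≤ ε ∧ x ∈ E₂ q}) := by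
        refine measure_mono ?_
        rintro x ⟨hx, ⟨v1, v2, v3⟩, ⟨w1, w2, w3⟩, hind, hwedge⟩
        obtain ⟨h1, h2, h3⟩ := plucker_bounds_of_wedgeNorm_le hβ hwedge
        simp only at h1 h2 h3
        by_cases hp : v1 * w3 - v3 * w1 = 0
        · right
          have hp' : (v1 * w3 - v3 * w1 : ℝ) = 0 := by exact_mod_cast hp
          rw [hp', zero_mul, zero_add] at h2
          rw [hp', mul_zero, add_zero] at h3
          refine ⟨v2 * w3 - v3 * w2, ?_, by push_cast; exact h2, hx, v1 * w2 - v2 * w1,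
            by push_cast; exact h3⟩
          intro hq
          have hq' : (v2 * w3 - v3 * w2 : ℝ) = 0 := by exact_mod_cast hq
          rw [hq', mul_zero, sub_zero] at h3
          have hr : |v1 * w2 - v2 * w1| < 1 := by exact_mod_cast h3.trans_lt hδ1
          have hr' : (v1 * w2 - v2 * w1 : ℝ) = 0 := by exact_mod_cast Int.abs_lt_one_iff.1 hr
          exact not_linearIndependent_of_plucker_eq_zero hr' hp' hq' hind
        · left
          exact ⟨v1 * w3 - v3 * w1, hp, by push_cast; exact h1, hx, v2 * w3 - v3 * w2,
            v1 * w2 - v2 * w1, by push_cast; exact h2, by push_cast; exact h3⟩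
    _ ≤ _ := measure_union_le _ _
    _ ≤ ENNReal.ofReal (2 * N) * ENNReal.ofReal (64 * ε * δ) +
          ENNReal.ofReal (16 * (δ * ε ^ 2)) := add_le_add hE₁ hE₂'
    _ = ENNReal.ofReal (128 * (N * ε * δ) + 16 * (δ * ε ^ 2)) := by
        rw [← ENNReal.ofReal_mul (by positivity), ← ENNReal.ofReal_add (by positivity)
          (by positivity)]
        ring_nf
    _ ≤ _ := by
        apply ENNReal.ofReal_le_ofReal
        have hNεδ : N * ε * δ = η ^ 3 * β ^ 2 := by
          have : β ^ 2 = √β ^ 4 := by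
            rw [show √β ^ 4 = (√β ^ 2) ^ 2 by ring, Real.sq_sqrt hβ.le]
          rw [hN, hε, hδ, this]
          field_simp
        have hδε : δ * ε ^ 2 ≤
            η ^ 3 * β ^ ((3:ℝ)/2) * Real.exp (-3 * (m : ℝ) / 2 + |s|) := by
          have hβ3 : β ^ ((3:ℝ)/2) = √β ^ 3 := by
            rw [Real.sqrt_eq_rpow, ← Real.rpow_natCast, ← Real.rpow_mul hβ.le]
            norm_num
          have hexp : Real.exp (-3 * (m : ℝ) / 2 + s) = Real.exp s / Real.exp (m / 2) ^ 3 := by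
            rw [← Real.exp_nat_mul, ← Real.exp_sub]
            congr 1
            push_cast
            ring
          calc δ * ε ^ 2 = η ^ 3 * √β ^ 3 * Real.exp (-3 * (m : ℝ) / 2 + s) := by
                rw [hexp, hε, hδ]
                field_simp
            _ ≤ _ := by
                rw [hβ3]
                gcongr
                exact le_abs_self s
        have hnonneg : 0 ≤ η ^ 4 * β ^ ((5:ℝ)/2) * Real.exp (-(m : ℝ) / 2 + s) := by positivity
        have : 0 ≤ δ * ε ^ 2 := by positivity
        rw [hNεδ]
        linarith

end
end

section
/- Fix c ∈ (0,1). There is a constant C_c, depending only on c, such that for all m ∈ ℤ² and all positive integers p, q: Vol(p^{-1}·a(m)Δ_c ∩ q^{-1}·Δ_c) ≤ C_c·p^{-3/2}·q^{-3/2}. -/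
open MeasureTheory
open scoped ENNReal Pointwise

noncomputable section

theorem DeltaC_subset {c : ℝ} (hc : 0 < c) :
    DeltaC c ⊆ Set.Icc (-c) c ×ˢ Set.Icc (-c) c ×ˢ Set.Icc 0 ((Real.exp 1 / c) ^ 2) := by
  rintro ⟨x₁, x₂, y⟩ ⟨hpos, hle, hx₁, hx₁', hx₂, hx₂'⟩
  dsimp only at *
  have hy : 0 < y := pos_of_mul_pos_right hpos (abs_nonneg _)
  have hd : 0 < (Real.exp 1)⁻¹ * c := by positivity
  have hprod : ((Real.exp 1)⁻¹ * c) ^ 2 ≤ |x₁ * x₂| := by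
    rw [abs_mul, sq]
    exact mul_le_mul hx₁.le hx₂.le hd.le (abs_nonneg _)
  have hyle : ((Real.exp 1)⁻¹ * c) ^ 2 * y ≤ 1 :=
    (mul_le_mul_of_nonneg_right hprod hy.le).trans hle
  refine ⟨abs_le.mp hx₁', abs_le.mp hx₂', hy.le, ?_⟩
  calc y = (Real.exp 1 / c) ^ 2 * (((Real.exp 1)⁻¹ * c) ^ 2 * y) := by field_simp
    _ ≤ (Real.exp 1 / c) ^ 2 * 1 := by gcongr
    _ = (Real.exp 1 / c) ^ 2 := mul_one _

theorem volume_smul_image_aMap_DeltaC_le {c : ℝ} (hc : 0 < c) (t : ℝ × ℝ) {r : ℝ} (hr : 0 ≤ r) :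
    volume (r • (aMap t '' DeltaC c)) ≤ ENNReal.ofReal (4 * Real.exp 1 ^ 2 * r ^ 3) := by
  set a := r * Real.exp t.1 with ha
  set b := r * Real.exp t.2 with hb
  set d := r * Real.exp (-t.1 - t.2) with hd
  have ha₀ : 0 ≤ a := by positivity
  have hb₀ : 0 ≤ b := by positivity
  have hd₀ : 0 ≤ d := by positivity
  have habd : a * b * d = r ^ 3 := by
    have h : Real.exp t.1 * Real.exp t.2 * Real.exp (-t.1 - t.2) = 1 := by
      rw [← Real.exp_add, ← Real.exp_add, ← Real.exp_zero]
      congr 1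
      ring
    calc a * b * d
        = r ^ 3 * (Real.exp t.1 * Real.exp t.2 * Real.exp (-t.1 - t.2)) := by
          rw [ha, hb, hd]; ring
      _ = r ^ 3 := by rw [h, mul_one]
  have hsub : r • (aMap t '' DeltaC c) ⊆
      Set.Icc (a * -c) (a * c) ×ˢ Set.Icc (b * -c) (b * c) ×ˢ
        Set.Icc 0 (d * (Real.exp 1 / c) ^ 2) := by
    rintro _ ⟨_, ⟨v, hv, rfl⟩, rfl⟩
    obtain ⟨⟨h₁, h₁'⟩, ⟨h₂, h₂'⟩, h₃, h₃'⟩ := DeltaC_subset hc hv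
    simp only [aMap, Prod.smul_mk, smul_eq_mul, ← mul_assoc, ← ha, ← hb, ← hd]
    exact ⟨⟨mul_le_mul_of_nonneg_left h₁ ha₀, mul_le_mul_of_nonneg_left h₁' ha₀⟩,
      ⟨mul_le_mul_of_nonneg_left h₂ hb₀, mul_le_mul_of_nonneg_left h₂' hb₀⟩,
      mul_nonneg hd₀ h₃, mul_le_mul_of_nonneg_left h₃' hd₀⟩
  refine (measure_mono hsub).trans_eq ?_
  rw [Measure.volume_eq_prod, Measure.prod_prod, Measure.volume_eq_prod, Measure.prod_prod,
    Real.volume_Icc, Real.volume_Icc, Real.volume_Icc,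
    ← ENNReal.ofReal_mul (by nlinarith [mul_nonneg hb₀ hc.le]),
    ← ENNReal.ofReal_mul (by nlinarith [mul_nonneg ha₀ hc.le]), ← habd]
  congr 1
  field_simp
  ring

theorem aMap_zero : aMap (0, 0) = id := by
  ext x <;> simp [aMap]

theorem inv_pow_three_le_rpow_mul_rpow {x y : ℝ} (hx : 0 < x) (hxy : x ≤ y) :
    y⁻¹ ^ 3 ≤ x ^ (-(3 : ℝ) / 2) * y ^ (-(3 : ℝ) / 2) := by
  have hy : 0 < y := hx.trans_le hxy
  calc y⁻¹ ^ 3 = y ^ (-(3 : ℝ) / 2) * y ^ (-(3 : ℝ) / 2) := by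
        rw [← Real.rpow_add hy, inv_pow, ← Real.rpow_natCast, ← Real.rpow_neg hy.le]
        norm_num
    _ ≤ x ^ (-(3 : ℝ) / 2) * y ^ (-(3 : ℝ) / 2) :=
        mul_le_mul_of_nonneg_right (Real.rpow_le_rpow_of_nonpos hx hxy (by norm_num))
          (by positivity)

theorem stmt15 (c : ℝ) (hc : c ∈ Set.Ioo (0:ℝ) 1) :
    ∃ C > 0, ∀ (m : ℤ × ℤ) (p q : ℕ), 0 < p → 0 < q →
      volume (((p : ℝ)⁻¹ • (aMap ((m.1 : ℝ), (m.2 : ℝ)) '' DeltaC c)) ∩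
          ((q : ℝ)⁻¹ • DeltaC c)) ≤
        ENNReal.ofReal (C * (p : ℝ) ^ (-(3:ℝ)/2) * (q : ℝ) ^ (-(3:ℝ)/2)) := by
  refine ⟨4 * Real.exp 1 ^ 2, by positivity, fun m p q hp hq => ?_⟩
  have hp' : (0 : ℝ) < p := Nat.cast_pos.mpr hp
  have hq' : (0 : ℝ) < q := Nat.cast_pos.mpr hq
  rw [mul_assoc]
  rcases le_total (p : ℝ) q with hpq | hpq
  · have h := volume_smul_image_aMap_DeltaC_le hc.1 (0, 0) (inv_nonneg.mpr hq'.le)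
    rw [aMap_zero, Set.image_id] at h
    refine (measure_mono Set.inter_subset_right).trans (h.trans (ENNReal.ofReal_le_ofReal ?_))
    gcongr
    exact inv_pow_three_le_rpow_mul_rpow hp' hpq
  · refine (measure_mono Set.inter_subset_left).trans
      ((volume_smul_image_aMap_DeltaC_le hc.1 _ (inv_nonneg.mpr hp'.le)).trans
        (ENNReal.ofReal_le_ofReal ?_))
    gcongr
    rw [mul_comm]
    exact inv_pow_three_le_rpow_mul_rpow hq' hpq

end
end
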